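/- arXiv:1803.01359 — 2 statements merged into one kernel-verified Lean document; each statement's English description precedes it below -/
import Mathlib

section
/- There exists a constant C > 0 with the following property. Let f, h : [1,T] → ℂ be continuously differentiable and f₁, h₁ : [1,T] → ℂ continuous, satisfying f'(t) + ν γ(t) f(t) = γ(t) f₁(t) and h'(t) + ν γ(t) h(t) + 2 k l (2π)^{−2} γ(t)^{−2} f(t) = h₁(t) for all t ∈ [1,T]. Then sup_{t∈[1,T]} e^{2aν^{1/3}t}|h(t)|² + ∫₁^T e^{2aν^{1/3}t} (2π k)² γ(t)^{−1} |h(t)|² dt + ν^{1/3} ∫₁^T e^{2aν^{1/3}t} |h(t)|² dt + ν ∫₁^T e^{2aν^{1/3}t} γ(t) |h(t)|² dt ≤ C ( |h(1)|² + (k²+l²)^{−2} |f(1)|² + ν^{−1} (k²+l²)^{−2} ∫₁^T e^{2aν^{1/3}t} γ(t) |f₁(t)|² dt + ν^{−1} (k²+l²)^{−1} ∫₁^T e^{2aν^{1/3}t} |h₁(t)|² dt ). The constant C is independent of ν, T, a, k, l, η and of f, h, f₁, h₁. -/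
/-- Total damping rate produced by dissipation together with the two ghost multipliers. -/
lemma enhanced_dissipation_rate {a δ τ κ m ν γ : ℝ} (hδ : 0 < δ) (hν : ν = δ ^ 3)
    (ha : a ≤ 4) (hm : 1 ≤ m)
    (hγ : γ = (2 * Real.pi) ^ 2 * (κ ^ 2 + (m * τ) ^ 2)) :
    2 * a * δ - 19 * (δ / (1 + (δ * τ) ^ 2)) - ν * γ / 2 ≤ -δ := by
  have hpi := Real.pi_gt_d2
  have hX : 0 ≤ (δ * τ) ^ 2 := sq_nonneg _
  have hγ' : 38 * τ ^ 2 ≤ γ := by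
    rw [hγ]
    have h1 : (38 : ℝ) ≤ (2 * Real.pi) ^ 2 := by nlinarith
    have h2 : τ ^ 2 ≤ κ ^ 2 + (m * τ) ^ 2 := by
      have : 1 ≤ m ^ 2 := by nlinarith
      nlinarith [sq_nonneg κ, mul_nonneg (sub_nonneg.2 this) (sq_nonneg τ)]
    exact mul_le_mul h1 h2 (sq_nonneg _) (by positivity)
  have hνγ : 38 * (δ * (δ * τ) ^ 2) ≤ ν * γ := by
    have : δ ^ 3 * (38 * τ ^ 2) ≤ δ ^ 3 * γ := by gcongr
    rw [hν]; nlinarith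
  have hQ : δ * (1 - (δ * τ) ^ 2) ≤ δ / (1 + (δ * τ) ^ 2) := by
    rw [le_div_iff₀ (by positivity)]
    nlinarith [mul_nonneg hδ.le (sq_nonneg ((δ * τ) ^ 2))]
  nlinarith

lemma inner_damped_forced_le (h h₁ f : ℂ) (c A : ℝ) :
    inner ℝ h (h₁ - (c : ℂ) * h - (A : ℂ) * f)
      ≤ ‖h‖ * ‖h₁‖ - c * ‖h‖ ^ 2 + |A| * (‖h‖ * ‖f‖) := by
  rw [← Complex.real_smul, ← Complex.real_smul, inner_sub_right, inner_sub_right,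
    real_inner_smul_right, real_inner_smul_right, real_inner_self_eq_norm_sq]
  have h1 := real_inner_le_norm h h₁
  have h2 : -(A * inner ℝ h f) ≤ |A| * (‖h‖ * ‖f‖) :=
    (neg_le_abs _).trans (by
      rw [abs_mul]
      exact mul_le_mul_of_nonneg_left (abs_real_inner_le_norm h f) (abs_nonneg A))
  linarith

/-- Pointwise energy inequality for the coupled system, before multiplication by the weight. -/
lemma energy_rate_le {a δ τ κ m ν γ A : ℝ} (h f h₁ f₁ : ℂ)
    (hδ : 0 < δ) (hν : ν = δ ^ 3) (ha : a ≤ 4) (hm : 1 ≤ m) (hκ : m ≤ κ)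
    (hγ : γ = (2 * Real.pi) ^ 2 * (κ ^ 2 + (m * τ) ^ 2))
    (hA : |A| ≤ 2 * m * κ / ((2 * Real.pi) ^ 2 * γ ^ 2)) :
    (2 * a * δ - m * κ / (κ ^ 2 + (m * τ) ^ 2) - 19 * (δ / (1 + (δ * τ) ^ 2)))
        * (‖h‖ ^ 2 + (κ ^ 4)⁻¹ * ‖f‖ ^ 2)
      + (2 * inner ℝ h (h₁ - ((ν * γ : ℝ) : ℂ) * h - (A : ℂ) * f)
        + (κ ^ 4)⁻¹ * (2 * inner ℝ f ((γ : ℂ) * f₁ - ((ν * γ : ℝ) : ℂ) * f)))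
      ≤ 2 * (ν⁻¹ * (κ ^ 2)⁻¹ * ‖h₁‖ ^ 2 + ν⁻¹ * (κ ^ 4)⁻¹ * (γ * ‖f₁‖ ^ 2))
        - ((2 * Real.pi * m) ^ 2 * γ⁻¹ / 2 + δ + ν * γ) * ‖h‖ ^ 2 := by
  have hκ1 : 1 ≤ κ := hm.trans hκ
  have hκ0 : 0 < κ := by linarith
  have hm0 : 0 < m := by linarith
  have hν0 : 0 < ν := by rw [hν]; positivity
  have hpi := Real.pi_gt_d2
  have h38 : (38 : ℝ) ≤ (2 * Real.pi) ^ 2 := by nlinarith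
  set Γ := κ ^ 2 + (m * τ) ^ 2 with hΓ
  have hΓκ : κ ^ 2 ≤ Γ := by nlinarith [sq_nonneg (m * τ)]
  have hΓ0 : 0 < Γ := by positivity
  have hγ0 : 0 < γ := by rw [hγ]; positivity
  have hκγ : κ ^ 2 ≤ γ := by rw [hγ]; nlinarith
  set P := m * κ / Γ with hP
  have hP0 : 0 ≤ P := by positivity
  set β := (κ ^ 4)⁻¹ with hβ
  have hβ0 : 0 ≤ β := by positivity
  have hrate := enhanced_dissipation_rate hδ hν ha hm hγ
  set Q := δ / (1 + (δ * τ) ^ 2) with hQ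
  have hPm : (2 * Real.pi * m) ^ 2 * γ⁻¹ ≤ P := by
    have : (2 * Real.pi * m) ^ 2 * γ⁻¹ = m * m / Γ := by
      rw [hγ]; field_simp
    rw [this, hP]; gcongr
  have hAP : |A| ≤ P / (2 * κ ^ 2) := by
    refine hA.trans ?_
    rw [hP, div_div, div_le_div_iff₀ (by positivity) (by positivity)]
    have h1 : 4 * (Γ * κ ^ 2) ≤ (2 * Real.pi) ^ 2 * γ ^ 2 := by
      have : Γ * κ ^ 2 ≤ γ ^ 2 := by
        have : Γ ≤ γ := by rw [hγ]; nlinarith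
        nlinarith
      nlinarith [sq_nonneg γ]
    nlinarith [mul_le_mul_of_nonneg_left h1 (mul_pos hm0 hκ0).le]
  have hcross : 2 * (|A| * (‖h‖ * ‖f‖)) ≤ P / 2 * (‖h‖ ^ 2 + β * ‖f‖ ^ 2) := by
    have h1 : |A| * (‖h‖ * ‖f‖) ≤ P / (2 * κ ^ 2) * (‖h‖ * ‖f‖) := by gcongr
    have h2 : 2 * (P / (2 * κ ^ 2) * (‖h‖ * ‖f‖)) = P / 2 * (2 * ‖h‖ * (‖f‖ / κ ^ 2)) := by
      field_simp
    have h3 : 2 * ‖h‖ * (‖f‖ / κ ^ 2) ≤ ‖h‖ ^ 2 + β * ‖f‖ ^ 2 := by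
      refine (two_mul_le_add_sq _ _).trans (le_of_eq ?_)
      rw [hβ]; field_simp
    have := mul_le_mul_of_nonneg_left h3 (div_nonneg hP0 zero_le_two)
    linarith
  have hyoung : ∀ x y : ℝ, 2 * (x * y) ≤ ν / 2 * x ^ 2 + 2 * (ν⁻¹ * y ^ 2) := by
    intro x y
    have : ν / 2 * x ^ 2 + 2 * (ν⁻¹ * y ^ 2) - 2 * (x * y) = ν / 2 * (x - 2 * ν⁻¹ * y) ^ 2 := by
      field_simp; ring
    nlinarith [mul_nonneg (half_pos hν0).le (sq_nonneg (x - 2 * ν⁻¹ * y))]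
  have hforce_h : 2 * (‖h‖ * ‖h₁‖) ≤ ν * γ / 2 * ‖h‖ ^ 2
      + 2 * (ν⁻¹ * (κ ^ 2)⁻¹ * ‖h₁‖ ^ 2) := by
    have h1 := hyoung (κ * ‖h‖) (‖h₁‖ / κ)
    have h2 : κ * ‖h‖ * (‖h₁‖ / κ) = ‖h‖ * ‖h₁‖ := by field_simp
    have h3 : ν⁻¹ * (‖h₁‖ / κ) ^ 2 = ν⁻¹ * (κ ^ 2)⁻¹ * ‖h₁‖ ^ 2 := by field_simp
    have h4 : ν / 2 * (κ * ‖h‖) ^ 2 ≤ ν * γ / 2 * ‖h‖ ^ 2 := by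
      have : ν / 2 * ‖h‖ ^ 2 * κ ^ 2 ≤ ν / 2 * ‖h‖ ^ 2 * γ := by gcongr
      linarith
    rw [h2, h3] at h1
    linarith
  have hforce_f : 2 * (γ * (‖f‖ * ‖f₁‖)) ≤ ν * γ / 2 * ‖f‖ ^ 2 + 2 * (ν⁻¹ * (γ * ‖f₁‖ ^ 2)) := by
    have := mul_le_mul_of_nonneg_left (hyoung ‖f‖ ‖f₁‖) hγ0.le
    linarith
  have hinh := inner_damped_forced_le h h₁ f (ν * γ) A
  have hinf : inner ℝ f ((γ : ℂ) * f₁ - ((ν * γ : ℝ) : ℂ) * f)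
      ≤ γ * (‖f‖ * ‖f₁‖) - ν * γ * ‖f‖ ^ 2 := by
    have := inner_damped_forced_le f ((γ : ℂ) * f₁) 0 (ν * γ) 0
    simp only [Complex.ofReal_zero, zero_mul, sub_zero, norm_mul, Complex.norm_real,
      Real.norm_eq_abs, abs_of_pos hγ0, abs_zero, add_zero] at this
    linarith
  have hf2 : β * (2 * inner ℝ f ((γ : ℂ) * f₁ - ((ν * γ : ℝ) : ℂ) * f))
      ≤ β * (2 * (ν⁻¹ * (γ * ‖f₁‖ ^ 2)) - 3 / 2 * (ν * γ) * ‖f‖ ^ 2) :=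
    mul_le_mul_of_nonneg_left (by linarith) hβ0
  have hS : 0 ≤ β * ‖f‖ ^ 2 := by positivity
  have hR1 : (2 * a * δ - 19 * Q - ν * γ / 2) * (‖h‖ ^ 2 + β * ‖f‖ ^ 2)
      ≤ -δ * (‖h‖ ^ 2 + β * ‖f‖ ^ 2) := mul_le_mul_of_nonneg_right hrate (by positivity)
  have hPh := mul_le_mul_of_nonneg_right hPm (sq_nonneg ‖h‖)
  have hPf : 0 ≤ P * (β * ‖f‖ ^ 2) := by positivity
  have hδf : 0 ≤ δ * (β * ‖f‖ ^ 2) := by positivity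
  have hνf : 0 ≤ ν * γ * (β * ‖f‖ ^ 2) := by positivity
  linarith

/-- The exponential weight multiplied by the two ghost multipliers. -/
noncomputable def ghostWeight (a δ κ m c : ℝ) (s : ℝ) : ℝ :=
  Real.exp (2 * a * δ * s) *
    Real.exp (-Real.arctan (m / κ * (s - c)) - 19 * Real.arctan (δ * (s - c)))

lemma ghostWeight_pos (a δ κ m c s : ℝ) : 0 < ghostWeight a δ κ m c s := by
  unfold ghostWeight; positivity

lemma le_ghostWeight (a δ κ m c s : ℝ) :
    Real.exp (2 * a * δ * s) ≤ Real.exp 40 * ghostWeight a δ κ m c s := by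
  have h1 := Real.arctan_lt_pi_div_two (m / κ * (s - c))
  have h2 := Real.arctan_lt_pi_div_two (δ * (s - c))
  have hpi := Real.pi_lt_d2
  rw [ghostWeight, ← Real.exp_add, ← Real.exp_add, Real.exp_le_exp]
  linarith

lemma ghostWeight_le (a δ κ m c s : ℝ) :
    ghostWeight a δ κ m c s ≤ Real.exp 40 * Real.exp (2 * a * δ * s) := by
  have h1 := Real.neg_pi_div_two_lt_arctan (m / κ * (s - c))
  have h2 := Real.neg_pi_div_two_lt_arctan (δ * (s - c))
  have hpi := Real.pi_lt_d2
  rw [ghostWeight, ← Real.exp_add, ← Real.exp_add, Real.exp_le_exp]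
  linarith

lemma hasDerivAt_ghostWeight (a δ m c s : ℝ) {κ : ℝ} (hκ : 0 < κ) :
    HasDerivAt (ghostWeight a δ κ m c)
      (ghostWeight a δ κ m c s * (2 * a * δ - m * κ / (κ ^ 2 + (m * (s - c)) ^ 2)
        - 19 * (δ / (1 + (δ * (s - c)) ^ 2)))) s := by
  have hid : HasDerivAt (fun s : ℝ => s - c) 1 s := (hasDerivAt_id s).sub_const c
  have h1 := ((hasDerivAt_id s).const_mul (2 * a * δ)).exp
  have h2 := (hid.const_mul (m / κ)).arctan
  have h3 := (hid.const_mul δ).arctan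
  have h4 := (h2.neg.sub (h3.const_mul 19)).exp
  refine (h1.mul h4).congr_deriv ?_
  have hP : m * κ / (κ ^ 2 + (m * (s - c)) ^ 2)
      = 1 / (1 + (m / κ * (s - c)) ^ 2) * (m / κ * 1) := by
    have : κ ^ 2 + (m * (s - c)) ^ 2 ≠ 0 := by positivity
    have h' : 1 + (m / κ * (s - c)) ^ 2 ≠ 0 := by positivity
    field_simp
  rw [hP]
  simp only [ghostWeight, id, Pi.neg_apply, Pi.sub_apply]
  ring

lemma continuous_ghostWeight (a δ m c : ℝ) {κ : ℝ} (hκ : 0 < κ) :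
    Continuous (ghostWeight a δ κ m c) :=
  continuous_iff_continuousAt.2 fun s => (hasDerivAt_ghostWeight a δ m c s hκ).continuousAt

/-- If `E' ≤ R - D` on `[1,T]` with `E, D, R ≥ 0`, then both `E` and `∫ D` are controlled by
the initial value of `E` and `∫ R`. -/
lemma energy_add_integral_le {E E' D R : ℝ → ℝ} {T : ℝ} (hT : 1 ≤ T)
    (hE : ∀ t ∈ Set.Icc 1 T, HasDerivWithinAt E (E' t) (Set.Icc 1 T) t)
    (hD : ContinuousOn D (Set.Icc 1 T)) (hR : ContinuousOn R (Set.Icc 1 T))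
    (hE0 : ∀ t ∈ Set.Icc 1 T, 0 ≤ E t) (hD0 : ∀ t ∈ Set.Icc 1 T, 0 ≤ D t)
    (hR0 : ∀ t ∈ Set.Icc 1 T, 0 ≤ R t)
    (hle : ∀ t ∈ Set.Icc 1 T, E' t ≤ R t - D t) {t : ℝ} (ht : t ∈ Set.Icc 1 T) :
    E t + ∫ s in (1:ℝ)..T, D s ≤ 2 * (E 1 + ∫ s in (1:ℝ)..T, R s) := by
  have key : ∀ u ∈ Set.Icc 1 T, E u + ∫ s in (1:ℝ)..u, D s ≤ E 1 + ∫ s in (1:ℝ)..T, R s := by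
    intro u hu
    have hsub : Set.Icc 1 u ⊆ Set.Icc 1 T := Set.Icc_subset_Icc_right hu.2
    have hDi : IntervalIntegrable D MeasureTheory.volume 1 u :=
      (hD.mono hsub).intervalIntegrable_of_Icc hu.1
    have hRi : IntervalIntegrable R MeasureTheory.volume 1 u :=
      (hR.mono hsub).intervalIntegrable_of_Icc hu.1
    have h1 : E u - E 1 ≤ ∫ s in (1:ℝ)..u, (R s - D s) := by
      refine intervalIntegral.sub_le_integral_of_hasDeriv_right_of_le hu.1
        (g' := E') (fun s hs => (hE s (hsub hs)).continuousWithinAt.mono hsub) ?_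
        (((hR.sub hD).mono hsub).integrableOn_Icc) ?_
      · intro s hs
        have hs' : s ∈ Set.Icc 1 T := hsub (Set.Ioo_subset_Icc_self hs)
        exact ((hE s hs').hasDerivAt
          (Icc_mem_nhds hs.1 (hs.2.trans_le hu.2))).hasDerivWithinAt
      · exact fun s hs => hle s (hsub (Set.Ioo_subset_Icc_self hs))
    rw [intervalIntegral.integral_sub hRi hDi] at h1
    have h2 : ∫ s in (1:ℝ)..u, R s ≤ ∫ s in (1:ℝ)..T, R s := by
      refine intervalIntegral.integral_mono_interval le_rfl hu.1 hu.2 ?_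
        (hR.intervalIntegrable_of_Icc hT)
      filter_upwards [MeasureTheory.ae_restrict_mem measurableSet_Ioc] with s hs
      exact hR0 s (Set.Ioc_subset_Icc_self hs)
    linarith
  have h1 := key t ht
  have h2 := key T ⟨hT, le_rfl⟩
  have h3 : 0 ≤ ∫ s in (1:ℝ)..t, D s :=
    intervalIntegral.integral_nonneg ht.1 fun s hs => hD0 s ⟨hs.1, hs.2.trans ht.2⟩
  have h4 := hE0 T ⟨hT, le_rfl⟩
  linarith

set_option maxHeartbeats 1000000 in
/-- Fixed-frequency estimate for the coupled linearized system for `(Δu², u³)` with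
pressure coupling `2∂_x∂_zΔ^{−2}`: if `f' + νγ f = γ f₁` and
`h' + νγ h + 2kl(2π)^{−2}γ^{−2} f = h₁` on `[1,T]`,
with `γ(t) = (2π)²(k² + (η − k t)² + l²)`, then `h` satisfies the stated bound. -/
theorem stmt10 : ∃ C : ℝ, 0 < C ∧ ∀ (ν T a : ℝ) (k l : ℤ) (η : ℝ)
    (f h f₁ h₁ : ℝ → ℂ),
    0 < ν → ν < 1 → 1 < T → 0 ≤ a → a ≤ 4 → k ≠ 0 →
    ContinuousOn f₁ (Set.Icc 1 T) → ContinuousOn h₁ (Set.Icc 1 T) →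
    ∀ γ : ℝ → ℝ,
    (∀ t, γ t = (2 * Real.pi) ^ 2 * ((k : ℝ) ^ 2 + (η - (k : ℝ) * t) ^ 2 + (l : ℝ) ^ 2)) →
    (∀ t ∈ Set.Icc (1:ℝ) T, HasDerivWithinAt f
        ((γ t : ℂ) * f₁ t - (ν : ℂ) * (γ t : ℂ) * f t) (Set.Icc (1:ℝ) T) t) →
    (∀ t ∈ Set.Icc (1:ℝ) T, HasDerivWithinAt h
        (h₁ t - (ν : ℂ) * (γ t : ℂ) * h t
          - ((2 * (k : ℝ) * (l : ℝ) / ((2 * Real.pi) ^ 2 * (γ t) ^ 2) : ℝ) : ℂ) * f t)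
        (Set.Icc (1:ℝ) T) t) →
    ∀ t ∈ Set.Icc (1:ℝ) T,
      Real.exp (2 * a * ν ^ ((1:ℝ)/3) * t) * ‖h t‖ ^ 2
      + (∫ s in (1:ℝ)..T, Real.exp (2 * a * ν ^ ((1:ℝ)/3) * s)
            * (2 * Real.pi * (k : ℝ)) ^ 2 * (γ s)⁻¹ * ‖h s‖ ^ 2)
      + ν ^ ((1:ℝ)/3) * (∫ s in (1:ℝ)..T, Real.exp (2 * a * ν ^ ((1:ℝ)/3) * s) * ‖h s‖ ^ 2)
      + ν * (∫ s in (1:ℝ)..T, Real.exp (2 * a * ν ^ ((1:ℝ)/3) * s) * γ s * ‖h s‖ ^ 2)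
      ≤ C * (‖h 1‖ ^ 2
        + (((k : ℝ) ^ 2 + (l : ℝ) ^ 2) ^ 2)⁻¹ * ‖f 1‖ ^ 2
        + ν⁻¹ * (((k : ℝ) ^ 2 + (l : ℝ) ^ 2) ^ 2)⁻¹ *
            (∫ s in (1:ℝ)..T, Real.exp (2 * a * ν ^ ((1:ℝ)/3) * s) * γ s * ‖f₁ s‖ ^ 2)
        + ν⁻¹ * ((k : ℝ) ^ 2 + (l : ℝ) ^ 2)⁻¹ *
            (∫ s in (1:ℝ)..T, Real.exp (2 * a * ν ^ ((1:ℝ)/3) * s) * ‖h₁ s‖ ^ 2)) := by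
  refine ⟨4 * Real.exp 88, by positivity, ?_⟩
  intro ν T a k l η f h f₁ h₁ hν0 hν1 hT ha0 ha4 hk hf₁ hh₁ γ hγ hf hh t ht
  set δ := ν ^ ((1:ℝ)/3) with hδ
  have hδ0 : 0 < δ := Real.rpow_pos_of_pos hν0 _
  have hδ1 : δ ≤ 1 := Real.rpow_le_one hν0.le hν1.le (by norm_num)
  have hδν : ν = δ ^ 3 := by
    rw [hδ, ← Real.rpow_natCast, ← Real.rpow_mul hν0.le]; norm_num
  have hkR : (k : ℝ) ≠ 0 := Int.cast_ne_zero.2 hk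
  obtain ⟨m, hm⟩ : ∃ m : ℝ, m = |(k : ℝ)| := ⟨_, rfl⟩
  have hm1 : 1 ≤ m := by
    rw [hm]; exact_mod_cast Int.one_le_abs hk
  have hmk : m ^ 2 = (k : ℝ) ^ 2 := by rw [hm, sq_abs]
  obtain ⟨κ, hκ⟩ : ∃ κ : ℝ, κ = √((k : ℝ) ^ 2 + (l : ℝ) ^ 2) := ⟨_, rfl⟩
  have hκ2 : (k : ℝ) ^ 2 + (l : ℝ) ^ 2 = κ ^ 2 := by rw [hκ, Real.sq_sqrt (by positivity)]
  have hmκ : m ≤ κ := by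
    rw [hκ, hm]; exact Real.abs_le_sqrt (by nlinarith [sq_nonneg (l : ℝ)])
  have hlκ : |(l : ℝ)| ≤ κ := by
    rw [hκ]; exact Real.abs_le_sqrt (by nlinarith [sq_nonneg (k : ℝ)])
  have hκ0 : 0 < κ := by linarith
  obtain ⟨c, hc⟩ : ∃ c : ℝ, c = η / k := ⟨_, rfl⟩
  have hγ' : ∀ s, γ s = (2 * Real.pi) ^ 2 * (κ ^ 2 + (m * (s - c)) ^ 2) := by
    intro s
    rw [hγ, mul_pow m, hmk, ← hκ2, hc]; field_simp; ring
  have hγ0 : ∀ s, 0 < γ s := by intro s; rw [hγ']; positivity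
  have hγc : Continuous γ := by
    rw [funext hγ']; fun_prop
  have hfc : ContinuousOn f (Set.Icc 1 T) := fun s hs => (hf s hs).continuousWithinAt
  have hhc : ContinuousOn h (Set.Icc 1 T) := fun s hs => (hh s hs).continuousWithinAt
  set W := ghostWeight a δ κ m c with hW
  have hWc : Continuous W := continuous_ghostWeight a δ m c hκ0
  have hW0 : ∀ s, 0 < W s := ghostWeight_pos a δ κ m c
  have hγinv : Continuous fun s => (γ s)⁻¹ := hγc.inv₀ fun s => (hγ0 s).ne'
  have hnh : ContinuousOn (fun s => ‖h s‖ ^ 2) (Set.Icc 1 T) := hhc.norm.pow 2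
  set D : ℝ → ℝ := fun s =>
    W s * (((2 * Real.pi * m) ^ 2 * (γ s)⁻¹ / 2 + δ + ν * γ s) * ‖h s‖ ^ 2) with hD
  set R : ℝ → ℝ := fun s => W s * (2 * (ν⁻¹ * (κ ^ 2)⁻¹ * ‖h₁ s‖ ^ 2
    + ν⁻¹ * (κ ^ 4)⁻¹ * (γ s * ‖f₁ s‖ ^ 2))) with hR
  set E : ℝ → ℝ := fun s => W s * (‖h s‖ ^ 2 + (κ ^ 4)⁻¹ * ‖f s‖ ^ 2) with hE
  have hDc : ContinuousOn D (Set.Icc 1 T) := by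
    refine hWc.continuousOn.mul (ContinuousOn.mul ?_ hnh)
    exact Continuous.continuousOn (by fun_prop)
  have hRc : ContinuousOn R (Set.Icc 1 T) := by
    have := hγc.continuousOn (s := Set.Icc 1 T)
    have := hWc.continuousOn (s := Set.Icc 1 T)
    fun_prop
  have henergy := energy_add_integral_le (E := E) (D := D) (R := R) hT.le (fun s hs =>
      (hasDerivAt_ghostWeight a δ m c s hκ0).hasDerivWithinAt.mul
        ((hh s hs).norm_sq.add ((hf s hs).norm_sq.const_mul (κ ^ 4)⁻¹)))
    hDc hRc (fun s _ => by have := hW0 s; positivity)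
    (fun s _ => by have := hW0 s; have := hγ0 s; positivity)
    (fun s _ => by have := hW0 s; have := hγ0 s; positivity)
    (fun s hs => by
      have hA : |2 * (k : ℝ) * (l : ℝ) / ((2 * Real.pi) ^ 2 * (γ s) ^ 2)|
          ≤ 2 * m * κ / ((2 * Real.pi) ^ 2 * γ s ^ 2) := by
        have hpos : 0 < (2 * Real.pi) ^ 2 * γ s ^ 2 := by have := hγ0 s; positivity
        rw [abs_div, abs_of_pos hpos, abs_mul, abs_mul, abs_two, hm]
        gcongr
      have := mul_le_mul_of_nonneg_left
        (energy_rate_le (h s) (f s) (h₁ s) (f₁ s) hδ0 hδν ha4 hm1 hmκ (hγ' s) hA) (hW0 s).le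
      rw [Complex.ofReal_mul ν (γ s)] at this
      simp only [hR, hD]
      rw [← hW]
      linarith) ht
  set e : ℝ → ℝ := fun s => Real.exp (2 * a * δ * s) with he
  have hec : Continuous e := by fun_prop
  have he0 : ∀ s, 0 < e s := fun s => Real.exp_pos _
  have heW : ∀ s, e s ≤ Real.exp 40 * W s := le_ghostWeight a δ κ m c
  have hWe : ∀ s, W s ≤ Real.exp 40 * e s := ghostWeight_le a δ κ m c
  have hint : ∀ {g : ℝ → ℝ}, ContinuousOn g (Set.Icc 1 T) →
      IntervalIntegrable g MeasureTheory.volume 1 T :=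
    fun hg => hg.intervalIntegrable_of_Icc hT.le
  have hec' := hec.continuousOn (s := Set.Icc 1 T)
  have hγc' := hγc.continuousOn (s := Set.Icc 1 T)
  have hγi' := hγinv.continuousOn (s := Set.Icc 1 T)
  have hi1 : IntervalIntegrable (fun s => e s * (2 * Real.pi * (k : ℝ)) ^ 2 * (γ s)⁻¹ * ‖h s‖ ^ 2)
      MeasureTheory.volume 1 T := hint (by fun_prop)
  have hi2 : IntervalIntegrable (fun s => e s * ‖h s‖ ^ 2) MeasureTheory.volume 1 T :=
    hint (by fun_prop)
  have hi3 : IntervalIntegrable (fun s => e s * γ s * ‖h s‖ ^ 2) MeasureTheory.volume 1 T :=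
    hint (by fun_prop)
  have hi4 : IntervalIntegrable (fun s => e s * γ s * ‖f₁ s‖ ^ 2) MeasureTheory.volume 1 T :=
    hint (by fun_prop)
  have hi5 : IntervalIntegrable (fun s => e s * ‖h₁ s‖ ^ 2) MeasureTheory.volume 1 T :=
    hint (by fun_prop)
  have hlow : (∫ s in (1:ℝ)..T, e s * (2 * Real.pi * (k : ℝ)) ^ 2 * (γ s)⁻¹ * ‖h s‖ ^ 2)
      + δ * (∫ s in (1:ℝ)..T, e s * ‖h s‖ ^ 2) + ν * (∫ s in (1:ℝ)..T, e s * γ s * ‖h s‖ ^ 2)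
      ≤ 2 * Real.exp 40 * ∫ s in (1:ℝ)..T, D s := by
    rw [← intervalIntegral.integral_const_mul, ← intervalIntegral.integral_const_mul,
      ← intervalIntegral.integral_const_mul,
      ← intervalIntegral.integral_add hi1 (hi2.const_mul δ),
      ← intervalIntegral.integral_add (hi1.add (hi2.const_mul δ)) (hi3.const_mul ν)]
    refine intervalIntegral.integral_mono_on hT.le
      ((hi1.add (hi2.const_mul δ)).add (hi3.const_mul ν)) ((hint hDc).const_mul _) fun s _ => ?_
    have hg := hγ0 s
    have hB : 0 ≤ ((2 * Real.pi * m) ^ 2 * (γ s)⁻¹ + 2 * δ + 2 * (ν * γ s)) * ‖h s‖ ^ 2 := by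
      positivity
    have h1 := mul_le_mul_of_nonneg_right (heW s) hB
    have h2 : 0 ≤ e s * (δ + ν * γ s) * ‖h s‖ ^ 2 := by have := he0 s; positivity
    have h3 : (2 * Real.pi * (k : ℝ)) ^ 2 = (2 * Real.pi * m) ^ 2 := by
      rw [mul_pow, mul_pow _ m, hmk]
    simp only [hD, h3]
    linarith
  have hupp : ∫ s in (1:ℝ)..T, R s ≤ 2 * Real.exp 40 *
      (ν⁻¹ * (κ ^ 4)⁻¹ * (∫ s in (1:ℝ)..T, e s * γ s * ‖f₁ s‖ ^ 2)
        + ν⁻¹ * (κ ^ 2)⁻¹ * (∫ s in (1:ℝ)..T, e s * ‖h₁ s‖ ^ 2)) := by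
    rw [← intervalIntegral.integral_const_mul (ν⁻¹ * (κ ^ 4)⁻¹),
      ← intervalIntegral.integral_const_mul (ν⁻¹ * (κ ^ 2)⁻¹),
      ← intervalIntegral.integral_add (hi4.const_mul _) (hi5.const_mul _),
      ← intervalIntegral.integral_const_mul]
    refine intervalIntegral.integral_mono_on hT.le (hint hRc)
      (((hi4.const_mul _).add (hi5.const_mul _)).const_mul _) fun s _ => ?_
    have hg := hγ0 s
    have hB : 0 ≤ 2 * (ν⁻¹ * (κ ^ 2)⁻¹ * ‖h₁ s‖ ^ 2
        + ν⁻¹ * (κ ^ 4)⁻¹ * (γ s * ‖f₁ s‖ ^ 2)) := by positivity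
    have h1 := mul_le_mul_of_nonneg_right (hWe s) hB
    simp only [hR]
    linarith
  have hJ4 : 0 ≤ ∫ s in (1:ℝ)..T, e s * γ s * ‖f₁ s‖ ^ 2 :=
    intervalIntegral.integral_nonneg hT.le fun s _ => by
      have := hγ0 s; have := he0 s; positivity
  have hJ5 : 0 ≤ ∫ s in (1:ℝ)..T, e s * ‖h₁ s‖ ^ 2 :=
    intervalIntegral.integral_nonneg hT.le fun s _ => by have := he0 s; positivity
  have hEt : e t * ‖h t‖ ^ 2 ≤ Real.exp 40 * E t := by
    have h1 := mul_le_mul_of_nonneg_right (heW t) (sq_nonneg ‖h t‖)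
    have h2 : 0 ≤ Real.exp 40 * W t * ((κ ^ 4)⁻¹ * ‖f t‖ ^ 2) := by have := hW0 t; positivity
    simp only [hE]
    linarith
  have hE1 : E 1 ≤ Real.exp 48 * (‖h 1‖ ^ 2 + (κ ^ 4)⁻¹ * ‖f 1‖ ^ 2) := by
    have h1 : W 1 ≤ Real.exp 48 := by
      refine (hWe 1).trans ?_
      rw [he, ← Real.exp_add, Real.exp_le_exp]
      nlinarith
    exact mul_le_mul_of_nonneg_right h1 (by positivity)
  rw [hκ2, ← pow_mul]
  have hE0 : 0 ≤ E t := by have := hW0 t; positivity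
  have hexp40 : 0 < Real.exp 40 := Real.exp_pos _
  have hexp88 : Real.exp 88 = Real.exp 40 * Real.exp 48 := by
    rw [← Real.exp_add]; norm_num
  have hexp48 : 2 * Real.exp 40 ≤ Real.exp 48 := by
    have h1 : Real.exp 48 = Real.exp 40 * Real.exp 8 := by rw [← Real.exp_add]; norm_num
    have h2 : 2 ≤ Real.exp 8 := by linarith [Real.add_one_le_exp (8 : ℝ)]
    rw [h1, mul_comm 2]
    exact mul_le_mul_of_nonneg_left h2 hexp40.le
  set X := ‖h 1‖ ^ 2 + (κ ^ 4)⁻¹ * ‖f 1‖ ^ 2 with hX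
  set Y := ν⁻¹ * (κ ^ 4)⁻¹ * (∫ s in (1:ℝ)..T, e s * γ s * ‖f₁ s‖ ^ 2)
        + ν⁻¹ * (κ ^ 2)⁻¹ * (∫ s in (1:ℝ)..T, e s * ‖h₁ s‖ ^ 2) with hY
  have hY0 : 0 ≤ Y := by positivity
  calc _ ≤ Real.exp 40 * E t + 2 * Real.exp 40 * ∫ s in (1:ℝ)..T, D s := by linarith
    _ ≤ 2 * Real.exp 40 * (E t + ∫ s in (1:ℝ)..T, D s) := by
        linarith only [mul_nonneg hexp40.le hE0]
    _ ≤ 2 * Real.exp 40 * (2 * (Real.exp 48 * X + Real.exp 48 * Y)) := by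
        refine mul_le_mul_of_nonneg_left ?_ (by positivity)
        have := mul_le_mul_of_nonneg_right hexp48 hY0
        linarith
    _ = 4 * Real.exp 88 * (X + Y) := by rw [hexp88]; ring
    _ = _ := by rw [hX, hY]; ring
end

section
/- There exists a constant C > 0 such that for all f₁, f₂ in the class below with ∂_x f₁ = 0, the following hold: (i) ‖f₁ f₂‖_{L²} ≤ C ‖f₁‖_{H¹} (‖f₂‖_{L²} + ‖∂_z f₂‖_{L²}); (ii) ‖∇(f₁ f₂)‖_{L²} ≤ C (‖f₁‖_{H¹} + ‖∂_z f₁‖_{H¹}) ‖f₂‖_{H¹}; (iii) ‖f₁ f₂‖_{H²} ≤ C ‖f₁‖_{H¹} (‖f₂‖_{H²} + ‖∂_z f₂‖_{H²}) + C ‖f₁‖_{H³} (‖f₂‖_{L²} + ‖∂_z f₂‖_{L²}); (iv) ‖f₁ f₂‖_{H³} ≤ C ‖f₁‖_{H¹} (‖f₂‖_{H³} + ‖∂_z f₂‖_{H³}) + C ‖f₁‖_{H³} (‖f₂‖_{H¹} + ‖∂_z f₂‖_{H¹}). Here ‖∇g‖_{L²}² = ‖∂_x g‖_{L²}² + ‖∂_y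 g‖_{L²}² + ‖∂_z g‖_{L²}². The constant C is independent of f₁, f₂. -/
open MeasureTheory

noncomputable section

/-- Partial derivative in the first variable `x`. -/
def pdx (f : ℝ → ℝ → ℝ → ℂ) : ℝ → ℝ → ℝ → ℂ :=
  fun x y z => deriv (fun x' => f x' y z) x

/-- Partial derivative in the second variable `y`. -/
def pdy (f : ℝ → ℝ → ℝ → ℂ) : ℝ → ℝ → ℝ → ℂ :=
  fun x y z => deriv (fun y' => f x y' z) y

/-- Partial derivative in the third variable `z`. -/
def pdz (f : ℝ → ℝ → ℝ → ℂ) : ℝ → ℝ → ℝ → ℂ :=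
  fun x y z => deriv (fun z' => f x y z') z

/-- Iterated partial derivative `∂^α` for a multi-index `α ∈ ℕ³`. -/
def pderiv3 (α : ℕ × ℕ × ℕ) (f : ℝ → ℝ → ℝ → ℂ) : ℝ → ℝ → ℝ → ℂ :=
  (pdx^[α.1]) ((pdy^[α.2.1]) ((pdz^[α.2.2]) f))

/-- Squared `L²` norm on `Ω = 𝕋 × ℝ × 𝕋` (with periods `1` in `x` and `z`):
`‖f‖_{L²}² = ∫₀¹∫_ℝ∫₀¹ |f(x,y,z)|² dx dy dz`. -/
def L2sq (f : ℝ → ℝ → ℝ → ℂ) : ℝ :=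
  ∫ x in Set.Ioc (0:ℝ) 1, ∫ y : ℝ, ∫ z in Set.Ioc (0:ℝ) 1, ‖f x y z‖ ^ 2

/-- `L²` norm on `Ω = 𝕋 × ℝ × 𝕋`. -/
def L2norm (f : ℝ → ℝ → ℝ → ℂ) : ℝ :=
  Real.sqrt (L2sq f)

/-- The multi-indices `α ∈ ℕ³` of order `|α| ≤ N`. -/
def multiIndicesLe (N : ℕ) : Finset (ℕ × ℕ × ℕ) :=
  (Finset.range (N+1) ×ˢ Finset.range (N+1) ×ˢ Finset.range (N+1)).filter
    fun α => α.1 + α.2.1 + α.2.2 ≤ N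

/-- Squared `H^N` norm: `‖f‖_{H^N}² = Σ_{|α| ≤ N} ‖∂^α f‖_{L²}²`. -/
def HNsq (N : ℕ) (f : ℝ → ℝ → ℝ → ℂ) : ℝ :=
  ∑ α ∈ multiIndicesLe N, L2sq (pderiv3 α f)

/-- `H^N` norm. -/
def HN (N : ℕ) (f : ℝ → ℝ → ℝ → ℂ) : ℝ :=
  Real.sqrt (HNsq N f)

/-- `L²` norm of the gradient: `‖∇f‖_{L²}² = ‖∂_x f‖² + ‖∂_y f‖² + ‖∂_z f‖²`. -/
def gradL2norm (f : ℝ → ℝ → ℝ → ℂ) : ℝ :=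
  Real.sqrt (L2sq (pdx f) + L2sq (pdy f) + L2sq (pdz f))

/-- The Laplacian `Δ = ∂_x² + ∂_y² + ∂_z²`. -/
def lap (f : ℝ → ℝ → ℝ → ℂ) : ℝ → ℝ → ℝ → ℂ :=
  pdx (pdx f) + pdy (pdy f) + pdz (pdz f)

/-- The operator `∂_x² + ∂_z²`. -/
def dxxzz (f : ℝ → ℝ → ℝ → ℂ) : ℝ → ℝ → ℝ → ℂ :=
  pdx (pdx f) + pdz (pdz f)

/-- The class of smooth functions `f : ℝ³ → ℂ` which are `1`-periodic in `x` and in `z`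
and, together with all partial derivatives, decay faster than any polynomial as
`|y| → ∞`. -/
structure GoodFn (f : ℝ → ℝ → ℝ → ℂ) : Prop where
  smooth : ContDiff ℝ (⊤ : ℕ∞) (fun p : ℝ × ℝ × ℝ => f p.1 p.2.1 p.2.2)
  per_x : ∀ x y z, f (x + 1) y z = f x y z
  per_z : ∀ x y z, f x y (z + 1) = f x y z
  decay : ∀ (α : ℕ × ℕ × ℕ) (n : ℕ), ∃ C : ℝ, ∀ x y z : ℝ,
    ‖pderiv3 α f x y z‖ * |y| ^ n ≤ C


open scoped ENNReal ContDiff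

/-- A function of three real variables, viewed as a function on `ℝ × ℝ × ℝ`. -/
def uncurry3 (f : ℝ → ℝ → ℝ → ℂ) : ℝ × ℝ × ℝ → ℂ :=
  fun p => f p.1 p.2.1 p.2.2

/-- Joint smoothness of a function of three real variables. -/
def Smooth3 (f : ℝ → ℝ → ℝ → ℂ) : Prop :=
  ContDiff ℝ ∞ (uncurry3 f)

/-- Directional derivative along the constant vector `v`. -/
def dirDeriv (v : ℝ × ℝ × ℝ) (f : ℝ → ℝ → ℝ → ℂ) : ℝ → ℝ → ℝ → ℂ :=
  fun x y z => fderiv ℝ (uncurry3 f) (x, y, z) v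

section Calculus

variable {f g : ℝ → ℝ → ℝ → ℂ}

theorem Smooth3.differentiable (hf : Smooth3 f) : Differentiable ℝ (uncurry3 f) :=
  ContDiff.differentiable hf (by simp)

theorem Smooth3.continuous (hf : Smooth3 f) : Continuous (uncurry3 f) :=
  ContDiff.continuous hf

theorem Smooth3.add (hf : Smooth3 f) (hg : Smooth3 g) :
    Smooth3 (fun x y z => f x y z + g x y z) :=
  ContDiff.add hf hg

theorem Smooth3.mul (hf : Smooth3 f) (hg : Smooth3 g) :
    Smooth3 (fun x y z => f x y z * g x y z) :=
  ContDiff.mul hf hg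

theorem Smooth3.dirDeriv (hf : Smooth3 f) (v : ℝ × ℝ × ℝ) : Smooth3 (dirDeriv v f) :=
  (ContDiff.fderiv_right (m := ∞) hf (by simp)).clm_apply contDiff_const

theorem dirDeriv_comm (hf : Smooth3 f) (v w : ℝ × ℝ × ℝ) :
    dirDeriv v (dirDeriv w f) = dirDeriv w (dirDeriv v f) := by
  have key : ∀ (v w : ℝ × ℝ × ℝ) (p : ℝ × ℝ × ℝ),
      fderiv ℝ (fun q => fderiv ℝ (uncurry3 f) q w) p v
        = fderiv ℝ (fderiv ℝ (uncurry3 f)) p v w := by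
    intro v w p
    have h : DifferentiableAt ℝ (fderiv ℝ (uncurry3 f)) p :=
      (ContDiff.fderiv_right (m := ∞) hf (by simp)).differentiable (by simp) p
    rw [fderiv_clm_apply h (differentiableAt_const w)]
    simp
  funext x y z
  have hs : IsSymmSndFDerivAt ℝ (uncurry3 f) (x, y, z) :=
    (ContDiff.contDiffAt hf).isSymmSndFDerivAt (by
      rw [minSmoothness_of_isRCLikeNormedField]
      exact WithTop.coe_le_coe.2 (le_top : (2 : ℕ∞) ≤ ⊤))
  exact (key v w (x, y, z)).trans ((hs v w).trans (key w v (x, y, z)).symm)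

theorem dirDeriv_add (hf : Smooth3 f) (hg : Smooth3 g) (v : ℝ × ℝ × ℝ) :
    dirDeriv v (fun x y z => f x y z + g x y z)
      = fun x y z => dirDeriv v f x y z + dirDeriv v g x y z := by
  funext x y z
  have := fderiv_fun_add (hf.differentiable (x, y, z)) (hg.differentiable (x, y, z))
  exact congrArg (fun L => L v) this

theorem dirDeriv_mul (hf : Smooth3 f) (hg : Smooth3 g) (v : ℝ × ℝ × ℝ) :
    dirDeriv v (fun x y z => f x y z * g x y z)
      = fun x y z => dirDeriv v f x y z * g x y z + f x y z * dirDeriv v g x y z := by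
  funext x y z
  have := fderiv_fun_mul (hf.differentiable (x, y, z)) (hg.differentiable (x, y, z))
  refine (congrArg (fun L => L v) this).trans ?_
  simp [dirDeriv, uncurry3]
  ring

theorem Smooth3.hasDerivAt_x (hf : Smooth3 f) (x y z : ℝ) :
    HasDerivAt (fun t => f t y z) (_root_.dirDeriv (1, 0, 0) f x y z) x :=
  (hf.differentiable (x, y, z)).hasFDerivAt.comp_hasDerivAt x
    (f := fun t : ℝ => (t, y, z))
    ((hasDerivAt_id x).prodMk ((hasDerivAt_const x y).prodMk (hasDerivAt_const x z)))

theorem Smooth3.hasDerivAt_y (hf : Smooth3 f) (x y z : ℝ) :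
    HasDerivAt (fun t => f x t z) (_root_.dirDeriv (0, 1, 0) f x y z) y :=
  (hf.differentiable (x, y, z)).hasFDerivAt.comp_hasDerivAt y
    (f := fun t : ℝ => (x, t, z))
    ((hasDerivAt_const y x).prodMk ((hasDerivAt_id y).prodMk (hasDerivAt_const y z)))

theorem Smooth3.hasDerivAt_z (hf : Smooth3 f) (x y z : ℝ) :
    HasDerivAt (fun t => f x y t) (_root_.dirDeriv (0, 0, 1) f x y z) z :=
  (hf.differentiable (x, y, z)).hasFDerivAt.comp_hasDerivAt z
    (f := fun t : ℝ => (x, y, t))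
    ((hasDerivAt_const z x).prodMk ((hasDerivAt_const z y).prodMk (hasDerivAt_id z)))

theorem pdx_eq_dirDeriv (hf : Smooth3 f) : pdx f = dirDeriv (1, 0, 0) f := by
  funext x y z
  exact (hf.hasDerivAt_x x y z).deriv

theorem pdy_eq_dirDeriv (hf : Smooth3 f) : pdy f = dirDeriv (0, 1, 0) f := by
  funext x y z
  exact (hf.hasDerivAt_y x y z).deriv

theorem pdz_eq_dirDeriv (hf : Smooth3 f) : pdz f = dirDeriv (0, 0, 1) f := by
  funext x y z
  exact (hf.hasDerivAt_z x y z).deriv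

theorem Smooth3.pdx (hf : Smooth3 f) : Smooth3 (pdx f) := by
  rw [pdx_eq_dirDeriv hf]; exact hf.dirDeriv _

theorem Smooth3.pdy (hf : Smooth3 f) : Smooth3 (pdy f) := by
  rw [pdy_eq_dirDeriv hf]; exact hf.dirDeriv _

theorem Smooth3.pdz (hf : Smooth3 f) : Smooth3 (pdz f) := by
  rw [pdz_eq_dirDeriv hf]; exact hf.dirDeriv _

theorem pdx_add (hf : Smooth3 f) (hg : Smooth3 g) :
    pdx (fun x y z => f x y z + g x y z) = fun x y z => pdx f x y z + pdx g x y z := by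
  rw [pdx_eq_dirDeriv (hf.add hg), pdx_eq_dirDeriv hf, pdx_eq_dirDeriv hg, dirDeriv_add hf hg]

theorem pdy_add (hf : Smooth3 f) (hg : Smooth3 g) :
    pdy (fun x y z => f x y z + g x y z) = fun x y z => pdy f x y z + pdy g x y z := by
  rw [pdy_eq_dirDeriv (hf.add hg), pdy_eq_dirDeriv hf, pdy_eq_dirDeriv hg, dirDeriv_add hf hg]

theorem pdz_add (hf : Smooth3 f) (hg : Smooth3 g) :
    pdz (fun x y z => f x y z + g x y z) = fun x y z => pdz f x y z + pdz g x y z := by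
  rw [pdz_eq_dirDeriv (hf.add hg), pdz_eq_dirDeriv hf, pdz_eq_dirDeriv hg, dirDeriv_add hf hg]

theorem pdx_mul (hf : Smooth3 f) (hg : Smooth3 g) :
    pdx (fun x y z => f x y z * g x y z)
      = fun x y z => pdx f x y z * g x y z + f x y z * pdx g x y z := by
  rw [pdx_eq_dirDeriv (hf.mul hg), pdx_eq_dirDeriv hf, pdx_eq_dirDeriv hg, dirDeriv_mul hf hg]

theorem pdy_mul (hf : Smooth3 f) (hg : Smooth3 g) :
    pdy (fun x y z => f x y z * g x y z)
      = fun x y z => pdy f x y z * g x y z + f x y z * pdy g x y z := by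
  rw [pdy_eq_dirDeriv (hf.mul hg), pdy_eq_dirDeriv hf, pdy_eq_dirDeriv hg, dirDeriv_mul hf hg]

theorem pdz_mul (hf : Smooth3 f) (hg : Smooth3 g) :
    pdz (fun x y z => f x y z * g x y z)
      = fun x y z => pdz f x y z * g x y z + f x y z * pdz g x y z := by
  rw [pdz_eq_dirDeriv (hf.mul hg), pdz_eq_dirDeriv hf, pdz_eq_dirDeriv hg, dirDeriv_mul hf hg]

theorem pdx_pdy_comm (hf : Smooth3 f) : pdx (pdy f) = pdy (pdx f) := by
  rw [pdx_eq_dirDeriv hf.pdy, pdy_eq_dirDeriv hf.pdx, pdx_eq_dirDeriv hf, pdy_eq_dirDeriv hf,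
    dirDeriv_comm hf]

theorem pdx_pdz_comm (hf : Smooth3 f) : pdx (pdz f) = pdz (pdx f) := by
  rw [pdx_eq_dirDeriv hf.pdz, pdz_eq_dirDeriv hf.pdx, pdx_eq_dirDeriv hf, pdz_eq_dirDeriv hf,
    dirDeriv_comm hf]

theorem pdy_pdz_comm (hf : Smooth3 f) : pdy (pdz f) = pdz (pdy f) := by
  rw [pdy_eq_dirDeriv hf.pdz, pdz_eq_dirDeriv hf.pdy, pdy_eq_dirDeriv hf, pdz_eq_dirDeriv hf,
    dirDeriv_comm hf]

theorem Smooth3.iterate {D : (ℝ → ℝ → ℝ → ℂ) → ℝ → ℝ → ℝ → ℂ}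
    (hD : ∀ h, Smooth3 h → Smooth3 (D h)) (hf : Smooth3 f) (n : ℕ) : Smooth3 (D^[n] f) := by
  induction n generalizing f with
  | zero => exact hf
  | succ n ih => exact ih (hD f hf)

theorem iterate_comm_of_smooth {D D' : (ℝ → ℝ → ℝ → ℂ) → ℝ → ℝ → ℝ → ℂ}
    (hD : ∀ h, Smooth3 h → Smooth3 (D h))
    (hc : ∀ h, Smooth3 h → D (D' h) = D' (D h)) (hf : Smooth3 f) (n : ℕ) :
    D^[n] (D' f) = D' (D^[n] f) := by
  induction n generalizing f with
  | zero => rfl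
  | succ n ih =>
    rw [Function.iterate_succ_apply, Function.iterate_succ_apply, hc f hf]
    exact ih (hD f hf)

theorem iterate_add_of_smooth {D : (ℝ → ℝ → ℝ → ℂ) → ℝ → ℝ → ℝ → ℂ}
    (hD : ∀ h, Smooth3 h → Smooth3 (D h))
    (ha : ∀ h k, Smooth3 h → Smooth3 k →
      D (fun x y z => h x y z + k x y z) = fun x y z => D h x y z + D k x y z)
    (hf : Smooth3 f) (hg : Smooth3 g) (n : ℕ) :
    D^[n] (fun x y z => f x y z + g x y z) = fun x y z => D^[n] f x y z + D^[n] g x y z := by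
  induction n generalizing f g with
  | zero => rfl
  | succ n ih =>
    rw [Function.iterate_succ_apply, Function.iterate_succ_apply, Function.iterate_succ_apply,
      ha f g hf hg]
    exact ih (hD f hf) (hD g hg)

theorem Smooth3.pderiv3 (hf : Smooth3 f) (α : ℕ × ℕ × ℕ) : Smooth3 (pderiv3 α f) :=
  (((hf.iterate (fun _ h => h.pdz) α.2.2).iterate (fun _ h => h.pdy) α.2.1).iterate
    (fun _ h => h.pdx) α.1)

theorem pderiv3_add (hf : Smooth3 f) (hg : Smooth3 g) (α : ℕ × ℕ × ℕ) :
    pderiv3 α (fun x y z => f x y z + g x y z)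
      = fun x y z => pderiv3 α f x y z + pderiv3 α g x y z := by
  have hz : ∀ {h}, Smooth3 h → Smooth3 (_root_.pdz^[α.2.2] h) := fun hh =>
    hh.iterate (fun _ h => h.pdz) _
  have hy : ∀ {h}, Smooth3 h → Smooth3 (_root_.pdy^[α.2.1] h) := fun hh =>
    hh.iterate (fun _ h => h.pdy) _
  unfold pderiv3
  rw [iterate_add_of_smooth (fun _ h => h.pdz) (fun _ _ => pdz_add) hf hg,
    iterate_add_of_smooth (fun _ h => h.pdy) (fun _ _ => pdy_add) (hz hf) (hz hg),
    iterate_add_of_smooth (fun _ h => h.pdx) (fun _ _ => pdx_add) (hy (hz hf)) (hy (hz hg))]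

theorem pderiv3_pdz (f : ℝ → ℝ → ℝ → ℂ) (a b c : ℕ) :
    pderiv3 (a, b, c) (pdz f) = pderiv3 (a, b, c + 1) f := rfl

theorem pderiv3_pdy (hf : Smooth3 f) (a b c : ℕ) :
    pderiv3 (a, b, c) (pdy f) = pderiv3 (a, b + 1, c) f := by
  simp only [pderiv3]
  rw [iterate_comm_of_smooth (fun _ h => h.pdz) (fun _ h => (pdy_pdz_comm h).symm) hf]
  rfl

theorem pderiv3_pdx (hf : Smooth3 f) (a b c : ℕ) :
    pderiv3 (a, b, c) (pdx f) = pderiv3 (a + 1, b, c) f := by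
  simp only [pderiv3]
  rw [iterate_comm_of_smooth (fun _ h => h.pdz) (fun _ h => (pdx_pdz_comm h).symm) hf,
    iterate_comm_of_smooth (fun _ h => h.pdy) (fun _ h => (pdx_pdy_comm h).symm)
      (hf.iterate (fun _ h => h.pdz) _)]
  rfl

theorem pdx_pderiv3 (hf : Smooth3 f) (α : ℕ × ℕ × ℕ) :
    pdx (pderiv3 α f) = pderiv3 α (pdx f) := by
  obtain ⟨a, b, c⟩ := α
  rw [pderiv3_pdx hf]
  simp only [pderiv3, Function.iterate_succ_apply']

theorem pdy_pderiv3 (hf : Smooth3 f) (α : ℕ × ℕ × ℕ) :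
    pdy (pderiv3 α f) = pderiv3 α (pdy f) := by
  obtain ⟨a, b, c⟩ := α
  rw [pderiv3_pdy hf]
  simp only [pderiv3, Function.iterate_succ_apply']
  exact (iterate_comm_of_smooth (D' := pdy) (fun _ h => h.pdx) (fun _ h => pdx_pdy_comm h)
    ((hf.iterate (fun _ h => h.pdz) _).iterate (fun _ h => h.pdy) _) a).symm

theorem pdz_pderiv3 (hf : Smooth3 f) (α : ℕ × ℕ × ℕ) :
    pdz (pderiv3 α f) = pderiv3 α (pdz f) := by
  obtain ⟨a, b, c⟩ := α
  have hz : Smooth3 (_root_.pdz^[c] f) := hf.iterate (fun _ h => h.pdz) _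
  rw [pderiv3_pdz]
  simp only [pderiv3, Function.iterate_succ_apply']
  rw [iterate_comm_of_smooth (D' := pdz) (fun _ h => h.pdy) (fun _ h => pdy_pdz_comm h) hz,
    iterate_comm_of_smooth (D' := pdz) (fun _ h => h.pdx) (fun _ h => pdx_pdz_comm h)
      (hz.iterate (fun _ h => h.pdy) _)]

theorem iterate_zero_of_map_zero {D : (ℝ → ℝ → ℝ → ℂ) → ℝ → ℝ → ℝ → ℂ}
    (hD : D (fun _ _ _ => 0) = fun _ _ _ => 0) (n : ℕ) :
    D^[n] (fun _ _ _ => 0) = fun _ _ _ => 0 :=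
  Function.iterate_fixed hD n

theorem pderiv3_zero (α : ℕ × ℕ × ℕ) :
    pderiv3 α (fun _ _ _ => 0) = fun _ _ _ => 0 := by
  unfold pderiv3
  rw [iterate_zero_of_map_zero (by funext x y z; simp [pdz]),
    iterate_zero_of_map_zero (by funext x y z; simp [pdy]),
    iterate_zero_of_map_zero (by funext x y z; simp [pdx])]

theorem pdx_pderiv3_eq_zero (hf : Smooth3 f) (h0 : ∀ x y z, pdx f x y z = 0)
    (α : ℕ × ℕ × ℕ) (x y z : ℝ) : pdx (pderiv3 α f) x y z = 0 := by
  have : pdx f = fun _ _ _ => 0 := by funext x y z; exact h0 x y z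
  rw [pdx_pderiv3 hf, this, pderiv3_zero]

theorem eq_of_pdx_eq_zero (hf : Smooth3 f) (h0 : ∀ x y z, pdx f x y z = 0) (x y z : ℝ) :
    f x y z = f 0 y z :=
  is_const_of_deriv_eq_zero (fun t => (hf.hasDerivAt_x t y z).differentiableAt)
    (fun t => h0 t y z) x 0

end Calculus

section Energy

/-- `∫₀¹ |f(x,y,z)|² dz` as an extended nonnegative number. -/
def energyZ (f : ℝ → ℝ → ℝ → ℂ) (x y : ℝ) : ℝ≥0∞ :=
  ∫⁻ z in Set.Ioc (0:ℝ) 1, ‖f x y z‖ₑ ^ 2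

/-- `∫_ℝ∫₀¹ |f(x,y,z)|² dz dy` as an extended nonnegative number. -/
def energyYZ (f : ℝ → ℝ → ℝ → ℂ) (x : ℝ) : ℝ≥0∞ :=
  ∫⁻ y : ℝ, energyZ f x y

/-- `‖f‖_{L²}²` as an extended nonnegative number. -/
def energy (f : ℝ → ℝ → ℝ → ℂ) : ℝ≥0∞ :=
  ∫⁻ x in Set.Ioc (0:ℝ) 1, energyYZ f x

variable {f : ℝ → ℝ → ℝ → ℂ}

theorem measurable_enorm_sq (hf : Continuous (uncurry3 f)) :
    Measurable (fun p : (ℝ × ℝ) × ℝ => ‖f p.1.1 p.1.2 p.2‖ₑ ^ 2) := by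
  have : Continuous fun p : (ℝ × ℝ) × ℝ => f p.1.1 p.1.2 p.2 :=
    hf.comp (f := fun p : (ℝ × ℝ) × ℝ => (p.1.1, p.1.2, p.2)) (by fun_prop)
  exact this.measurable.enorm.pow_const 2

theorem measurable_energyZ (hf : Continuous (uncurry3 f)) :
    Measurable (fun p : ℝ × ℝ => energyZ f p.1 p.2) :=
  (measurable_enorm_sq hf).lintegral_prod_right'

theorem measurable_energyYZ (hf : Continuous (uncurry3 f)) : Measurable (energyYZ f) :=
  (measurable_energyZ hf).lintegral_prod_right'

theorem measurable_energyZ_right (hf : Continuous (uncurry3 f)) (x : ℝ) :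
    Measurable (energyZ f x) :=
  (measurable_energyZ hf).comp measurable_prodMk_left

theorem measurable_enorm_sq_right (hf : Continuous (uncurry3 f)) (x y : ℝ) :
    Measurable (fun z => ‖f x y z‖ₑ ^ 2) :=
  (measurable_enorm_sq hf).comp (measurable_prodMk_left (x := (x, y)))

theorem measurable_enorm_sq_middle (hf : Continuous (uncurry3 f)) (x z : ℝ) :
    Measurable (fun y => ‖f x y z‖ₑ ^ 2) :=
  (measurable_enorm_sq hf).comp (g := fun p : (ℝ × ℝ) × ℝ => ‖f p.1.1 p.1.2 p.2‖ₑ ^ 2)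
    (f := fun y => ((x, y), z)) (by fun_prop)

theorem energyZ_ne_top (hf : Continuous (uncurry3 f)) (x y : ℝ) : energyZ f x y ≠ ⊤ := by
  have hc : Continuous fun z => f x y z :=
    hf.comp (f := fun z : ℝ => (x, y, z)) (by fun_prop)
  have hi : IntegrableOn (fun z => ‖f x y z‖ ^ 2) (Set.Ioc 0 1) :=
    ((hc.norm.pow 2).integrableOn_Icc (a := 0) (b := 1)).mono_set Set.Ioc_subset_Icc_self
  have := hi.hasFiniteIntegral
  simpa [HasFiniteIntegral, energyZ, enorm_pow] using this.ne

theorem integral_norm_sq_eq_energyZ (hf : Continuous (uncurry3 f)) (x y : ℝ) :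
    ∫ z in Set.Ioc (0:ℝ) 1, ‖f x y z‖ ^ 2 = (energyZ f x y).toReal := by
  rw [energyZ, ← integral_toReal (measurable_enorm_sq_right hf x y).aemeasurable
    (Filter.Eventually.of_forall fun z => by simp)]
  simp

theorem L2sq_eq_toReal_energy (hf : Continuous (uncurry3 f)) (hE : energy f ≠ ⊤) :
    L2sq f = (energy f).toReal := by
  have hfin : ∀ᵐ x ∂(volume.restrict (Set.Ioc (0:ℝ) 1)), energyYZ f x < ⊤ :=
    ae_lt_top (measurable_energyYZ hf) hE
  rw [energy, ← integral_toReal (measurable_energyYZ hf).aemeasurable hfin, L2sq]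
  refine integral_congr_ae (Filter.Eventually.of_forall fun x => ?_)
  simp only [integral_norm_sq_eq_energyZ hf]
  exact integral_toReal (measurable_energyZ_right hf x).aemeasurable
    (Filter.Eventually.of_forall fun y => (energyZ_ne_top hf x y).lt_top)

theorem energy_ne_top_of_bound (C₀ C₁ : ℝ) (h0 : ∀ x y z, ‖f x y z‖ ≤ C₀)
    (h1 : ∀ x y z, ‖f x y z‖ * |y| ≤ C₁) : energy f ≠ ⊤ := by
  have hb : ∀ x y z, ‖f x y z‖ₑ ^ 2 ≤ ENNReal.ofReal ((C₀ ^ 2 + C₁ ^ 2) * (1 + y ^ 2)⁻¹) := by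
    intro x y z
    rw [← ofReal_norm, ← ENNReal.ofReal_pow (norm_nonneg _)]
    refine ENNReal.ofReal_le_ofReal ?_
    rw [← div_eq_mul_inv, le_div_iff₀ (by positivity)]
    have e0 := pow_le_pow_left₀ (norm_nonneg _) (h0 x y z) 2
    have e1 := pow_le_pow_left₀ (by positivity) (h1 x y z) 2
    rw [mul_pow, sq_abs] at e1
    linarith
  have hI : Integrable (fun y : ℝ => (C₀ ^ 2 + C₁ ^ 2) * (1 + y ^ 2)⁻¹) :=
    integrable_inv_one_add_sq.const_mul _
  have hz : ∀ x y, energyZ f x y ≤ ENNReal.ofReal ((C₀ ^ 2 + C₁ ^ 2) * (1 + y ^ 2)⁻¹) := by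
    intro x y
    refine (lintegral_mono fun z => hb x y z).trans ?_
    simp
  have hyz : ∀ x, energyYZ f x
      ≤ ENNReal.ofReal (∫ y : ℝ, (C₀ ^ 2 + C₁ ^ 2) * (1 + y ^ 2)⁻¹) := by
    intro x
    rw [ofReal_integral_eq_lintegral_ofReal hI
      (Filter.Eventually.of_forall fun y => by positivity)]
    exact lintegral_mono fun y => hz x y
  refine ne_top_of_le_ne_top ?_ (lintegral_mono fun x => hyz x)
  simp

theorem energy_add_le (hf : Continuous (uncurry3 f)) (g : ℝ → ℝ → ℝ → ℂ) :
    energy (fun x y z => f x y z + g x y z) ≤ 2 * (energy f + energy g) := by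
  have hp : ∀ x y z, ‖f x y z + g x y z‖ₑ ^ 2 ≤ 2 * (‖f x y z‖ₑ ^ 2 + ‖g x y z‖ₑ ^ 2) := by
    intro x y z
    simp only [← ofReal_norm]
    rw [← ENNReal.ofReal_pow (norm_nonneg _), ← ENNReal.ofReal_pow (norm_nonneg _),
      ← ENNReal.ofReal_pow (norm_nonneg _), ← ENNReal.ofReal_add (by positivity) (by positivity),
      ← ENNReal.ofReal_ofNat 2, ← ENNReal.ofReal_mul (by norm_num)]
    refine ENNReal.ofReal_le_ofReal ?_
    have := pow_le_pow_left₀ (norm_nonneg _) (norm_add_le (f x y z) (g x y z)) 2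
    nlinarith [sq_nonneg (‖f x y z‖ - ‖g x y z‖)]
  calc energy (fun x y z => f x y z + g x y z)
      ≤ ∫⁻ x in Set.Ioc (0:ℝ) 1, ∫⁻ y : ℝ, ∫⁻ z in Set.Ioc (0:ℝ) 1,
          2 * (‖f x y z‖ₑ ^ 2 + ‖g x y z‖ₑ ^ 2) :=
        lintegral_mono fun x => lintegral_mono fun y => lintegral_mono fun z => hp x y z
    _ = ∫⁻ x in Set.Ioc (0:ℝ) 1, ∫⁻ y : ℝ, 2 * (energyZ f x y + energyZ g x y) := by
        refine lintegral_congr fun x => lintegral_congr fun y => ?_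
        rw [lintegral_const_mul' _ _ (by simp),
          lintegral_add_left (measurable_enorm_sq_right hf x y)]
        rfl
    _ = ∫⁻ x in Set.Ioc (0:ℝ) 1, 2 * (energyYZ f x + energyYZ g x) := by
        refine lintegral_congr fun x => ?_
        rw [lintegral_const_mul' _ _ (by simp),
          lintegral_add_left (measurable_energyZ_right hf x)]
        rfl
    _ = 2 * (energy f + energy g) := by
        rw [lintegral_const_mul' _ _ (by simp), lintegral_add_left (measurable_energyYZ hf)]
        rfl

theorem energy_zero : energy (fun _ _ _ => 0) = 0 := by
  simp [energy, energyYZ, energyZ]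

theorem energyYZ_eq_energy (hf : ∀ x y z, f x y z = f 0 y z) (x : ℝ) :
    energyYZ f x = energy f := by
  have h0 : ∀ x, energyYZ f x = energyYZ f 0 := fun x => by
    simp only [energyYZ, energyZ, hf x]
  simp [energy, h0]

/-- One-dimensional Sobolev embedding on an interval of unit length. -/
theorem enorm_sq_le_of_hasDerivAt {u u' : ℝ → ℂ} (hu : ∀ t, HasDerivAt u (u' t) t)
    (hu' : Continuous u') {a s : ℝ} (hs : s ∈ Set.Icc a (a + 1)) :
    ‖u s‖ₑ ^ 2 ≤ 2 * ((∫⁻ t in Set.Ioc a (a + 1), ‖u t‖ₑ ^ 2)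
      + ∫⁻ t in Set.Ioc a (a + 1), ‖u' t‖ₑ ^ 2) := by
  have hc : Continuous u := continuous_iff_continuousAt.2 fun t => (hu t).continuousAt
  have hint : ∀ {v : ℝ → ℂ}, Continuous v →
      IntegrableOn (fun t => ‖v t‖ ^ 2) (Set.Ioc a (a + 1)) := fun {v} hv =>
    ((hv.norm.pow 2).integrableOn_Icc (a := a) (b := a + 1)).mono_set Set.Ioc_subset_Icc_self
  set A := ∫ t in Set.Ioc a (a + 1), ‖u t‖ ^ 2 with hA
  set B := ∫ t in Set.Ioc a (a + 1), ‖u' t‖ ^ 2 with hB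
  have hconv : ∀ {v : ℝ → ℂ}, Continuous v →
      ∫⁻ t in Set.Ioc a (a + 1), ‖v t‖ₑ ^ 2
        = ENNReal.ofReal (∫ t in Set.Ioc a (a + 1), ‖v t‖ ^ 2) := by
    intro v hv
    rw [ofReal_integral_eq_lintegral_ofReal (hint hv)
      (Filter.Eventually.of_forall fun t => by positivity)]
    refine lintegral_congr fun t => ?_
    rw [← ofReal_norm, ENNReal.ofReal_pow (norm_nonneg _)]
  have hB0 : 0 ≤ B := integral_nonneg fun t => by positivity
  have hA0 : 0 ≤ A := integral_nonneg fun t => by positivity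
  have hpt : ∀ t ∈ Set.Ioc a (a + 1), ‖u s‖ ^ 2 ≤ ‖u t‖ ^ 2 + (A + B) := by
    intro t ht
    have hd : ∀ r, HasDerivAt (fun r => ‖u r‖ ^ 2) (2 * inner ℝ (u r) (u' r)) r :=
      fun r => (hu r).norm_sq
    have hcont : Continuous fun r => 2 * inner ℝ (u r) (u' r) :=
      continuous_const.mul (hc.inner hu')
    have hftc := intervalIntegral.integral_eq_sub_of_hasDerivAt (a := t) (b := s)
      (fun r _ => hd r) (hcont.intervalIntegrable _ _)
    have hle : ‖∫ r in t..s, 2 * inner ℝ (u r) (u' r)‖ ≤ A + B := by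
      refine (intervalIntegral.norm_integral_le_integral_norm_uIoc).trans ?_
      rw [hA, hB, ← integral_add (hint hc) (hint hu')]
      have hsub : Set.uIoc t s ⊆ Set.Ioc a (a + 1) := by
        rw [Set.uIoc]
        exact Set.Ioc_subset_Ioc (le_min ht.1.le hs.1) (max_le ht.2 hs.2)
      refine (setIntegral_mono_set (f := fun r => ‖2 * inner ℝ (u r) (u' r)‖) ?_ ?_
        hsub.eventuallyLE).trans ?_
      · exact (hcont.norm.integrableOn_Icc (a := a) (b := a + 1)).mono_set
          Set.Ioc_subset_Icc_self
      · exact Filter.Eventually.of_forall fun r => norm_nonneg _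
      · refine setIntegral_mono ?_ ((hint hc).add (hint hu')) fun r => ?_
        · exact (hcont.norm.integrableOn_Icc (a := a) (b := a + 1)).mono_set
            Set.Ioc_subset_Icc_self
        · have h1 := norm_inner_le_norm (𝕜 := ℝ) (u r) (u' r)
          simp only [norm_mul, Real.norm_ofNat]
          nlinarith [sq_nonneg (‖u r‖ - ‖u' r‖)]
    rw [hftc] at hle
    have := (le_abs_self _).trans hle
    linarith
  have hmain : ‖u s‖ ^ 2 ≤ 2 * (A + B) := by
    have := setIntegral_mono_on (μ := volume) (s := Set.Ioc a (a + 1))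
      (f := fun _ => ‖u s‖ ^ 2) (g := fun t => ‖u t‖ ^ 2 + (A + B))
      (integrableOn_const (by simp)) ((hint hc).add (integrableOn_const (by simp)))
      measurableSet_Ioc hpt
    rw [integral_add (hint hc) (integrableOn_const (by simp))] at this
    simp only [setIntegral_const, Measure.real, Real.volume_Ioc] at this
    norm_num at this
    linarith
  rw [hconv hc, hconv hu', ← ENNReal.ofReal_add hA0 hB0, ← ENNReal.ofReal_ofNat 2,
    ← ENNReal.ofReal_mul (by norm_num), ← ofReal_norm, ← ENNReal.ofReal_pow (norm_nonneg _)]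
  exact ENNReal.ofReal_le_ofReal hmain

theorem enorm_sq_le_energyZ (hf : Smooth3 f) (x y : ℝ) {z : ℝ} (hz : z ∈ Set.Ioc (0:ℝ) 1) :
    ‖f x y z‖ₑ ^ 2 ≤ 2 * (energyZ f x y + energyZ (pdz f) x y) := by
  have hd : ∀ t, HasDerivAt (fun t => f x y t) (pdz f x y t) t := fun t => by
    rw [pdz_eq_dirDeriv hf]; exact hf.hasDerivAt_z x y t
  have hc : Continuous fun t => pdz f x y t :=
    hf.pdz.continuous.comp (f := fun t : ℝ => (x, y, t)) (by fun_prop)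
  simpa [energyZ] using enorm_sq_le_of_hasDerivAt hd hc (a := 0) (s := z)
    ⟨hz.1.le, by simpa using hz.2⟩

theorem energyZ_le_energyYZ (hf : Smooth3 f) (x y : ℝ) :
    energyZ f x y ≤ 2 * (energyYZ f x + energyYZ (pdy f) x) := by
  have hswap : ∀ {k}, Smooth3 k →
      ∫⁻ z in Set.Ioc (0:ℝ) 1, ∫⁻ y : ℝ, ‖k x y z‖ₑ ^ 2 = energyYZ k x := by
    intro k hk
    refine lintegral_lintegral_swap (f := fun z y => ‖k x y z‖ₑ ^ 2) ?_
    exact ((measurable_enorm_sq hk.continuous).comp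
      (g := fun p : (ℝ × ℝ) × ℝ => ‖k p.1.1 p.1.2 p.2‖ₑ ^ 2)
      (f := fun q : ℝ × ℝ => ((x, q.2), q.1)) (by fun_prop)).aemeasurable
  have hmeas : Measurable fun z => ∫⁻ y : ℝ, ‖f x y z‖ₑ ^ 2 :=
    Measurable.lintegral_prod_right' (f := fun q : ℝ × ℝ => ‖f x q.2 q.1‖ₑ ^ 2)
      ((measurable_enorm_sq hf.continuous).comp
        (g := fun p : (ℝ × ℝ) × ℝ => ‖f p.1.1 p.1.2 p.2‖ₑ ^ 2)
        (f := fun q : ℝ × ℝ => ((x, q.2), q.1)) (by fun_prop))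
  have hpt : ∀ z, ‖f x y z‖ₑ ^ 2
      ≤ 2 * ((∫⁻ y : ℝ, ‖f x y z‖ₑ ^ 2) + ∫⁻ y : ℝ, ‖pdy f x y z‖ₑ ^ 2) := by
    intro z
    have hd : ∀ t, HasDerivAt (fun t => f x t z) (pdy f x t z) t := fun t => by
      rw [pdy_eq_dirDeriv hf]; exact hf.hasDerivAt_y x t z
    have hc : Continuous fun t => pdy f x t z :=
      hf.pdy.continuous.comp (f := fun t : ℝ => (x, t, z)) (by fun_prop)
    refine (enorm_sq_le_of_hasDerivAt hd hc (a := y) (s := y) ⟨le_rfl, by linarith⟩).trans ?_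
    gcongr <;> exact Measure.restrict_le_self
  refine (lintegral_mono fun z => hpt z).trans (le_of_eq ?_)
  rw [lintegral_const_mul' _ _ (by simp), lintegral_add_left hmeas, hswap hf, hswap hf.pdy]

/-- Sobolev embedding in the two variables `y` and `z`. -/
theorem enorm_sq_le_energyYZ (hf : Smooth3 f) (x y : ℝ) {z : ℝ} (hz : z ∈ Set.Ioc (0:ℝ) 1) :
    ‖f x y z‖ₑ ^ 2 ≤ 4 * (energyYZ f x + energyYZ (pdy f) x
      + (energyYZ (pdz f) x + energyYZ (pdy (pdz f)) x)) := by
  refine (enorm_sq_le_energyZ hf x y hz).trans ?_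
  refine (mul_le_mul_right (add_le_add (energyZ_le_energyYZ hf x y)
    (energyZ_le_energyYZ hf.pdz x y)) 2).trans (le_of_eq ?_)
  ring

end Energy

section Bilinear

variable {g h : ℝ → ℝ → ℝ → ℂ}

/-- If the `x`-independent factor is bounded in `L^∞_y L²_z`, then so is the product. -/
theorem energy_mul_le_of_energyZ (hg : Smooth3 g) (hh : Smooth3 h)
    (hgx : ∀ x y z, pdx g x y z = 0) :
    energy (fun x y z => g x y z * h x y z)
      ≤ 4 * (energy g + energy (pdy g)) * (energy h + energy (pdz h)) := by
  have hgi := eq_of_pdx_eq_zero hg hgx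
  have hgyi := eq_of_pdx_eq_zero hg.pdy (pdx_pderiv3_eq_zero hg hgx (0, 1, 0))
  have hbound : ∀ x y, energyZ (fun x y z => g x y z * h x y z) x y
      ≤ 4 * (energy g + energy (pdy g)) * (energyZ h x y + energyZ (pdz h) x y) := by
    intro x y
    calc energyZ (fun x y z => g x y z * h x y z) x y
        ≤ ∫⁻ z in Set.Ioc (0:ℝ) 1,
            ‖g x y z‖ₑ ^ 2 * (2 * (energyZ h x y + energyZ (pdz h) x y)) := by
          refine setLIntegral_mono' measurableSet_Ioc fun z hz => ?_
          rw [enorm_mul, mul_pow]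
          gcongr
          exact enorm_sq_le_energyZ hh x y hz
      _ = energyZ g x y * (2 * (energyZ h x y + energyZ (pdz h) x y)) :=
          lintegral_mul_const _ (measurable_enorm_sq_right hg.continuous x y)
      _ ≤ (2 * (energy g + energy (pdy g))) * (2 * (energyZ h x y + energyZ (pdz h) x y)) := by
          gcongr
          rw [← energyYZ_eq_energy hgi x, ← energyYZ_eq_energy hgyi x]
          exact energyZ_le_energyYZ hg x y
      _ = _ := by ring
  have hmY : ∀ x, Measurable fun y => energyZ h x y + energyZ (pdz h) x y := fun x =>
    (measurable_energyZ_right hh.continuous x).add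
      (measurable_energyZ_right hh.pdz.continuous x)
  calc energy (fun x y z => g x y z * h x y z)
      ≤ ∫⁻ x in Set.Ioc (0:ℝ) 1, ∫⁻ y : ℝ,
          4 * (energy g + energy (pdy g)) * (energyZ h x y + energyZ (pdz h) x y) :=
        lintegral_mono fun x => lintegral_mono fun y => hbound x y
    _ = ∫⁻ x in Set.Ioc (0:ℝ) 1,
          4 * (energy g + energy (pdy g)) * (energyYZ h x + energyYZ (pdz h) x) := by
        refine lintegral_congr fun x => ?_
        rw [lintegral_const_mul _ (hmY x),
          lintegral_add_left (measurable_energyZ_right hh.continuous x)]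
        rfl
    _ = _ := by
        have m0 := measurable_energyYZ hh.continuous
        have m1 := measurable_energyYZ hh.pdz.continuous
        rw [lintegral_const_mul _ (by fun_prop), lintegral_add_left m0]
        rfl

/-- The `x`-independent factor in `L²`, the other one in `L²_x L^∞_{y,z}`. -/
theorem energy_mul_le_of_sup_right (hg : Smooth3 g) (hh : Smooth3 h)
    (hgx : ∀ x y z, pdx g x y z = 0) :
    energy (fun x y z => g x y z * h x y z)
      ≤ 4 * energy g * (energy h + energy (pdy h) + (energy (pdz h) + energy (pdy (pdz h)))) := by
  have hgi := eq_of_pdx_eq_zero hg hgx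
  have m0 := measurable_energyYZ hh.continuous
  have m1 := measurable_energyYZ hh.pdy.continuous
  have m2 := measurable_energyYZ hh.pdz.continuous
  have m3 := measurable_energyYZ hh.pdz.pdy.continuous
  set J : ℝ → ℝ≥0∞ := fun x => 4 * (energyYZ h x + energyYZ (pdy h) x
    + (energyYZ (pdz h) x + energyYZ (pdy (pdz h)) x)) with hJ
  have hbound : ∀ x, energyYZ (fun x y z => g x y z * h x y z) x ≤ energy g * J x := by
    intro x
    calc energyYZ (fun x y z => g x y z * h x y z) x
        ≤ ∫⁻ y : ℝ, ∫⁻ z in Set.Ioc (0:ℝ) 1, ‖g x y z‖ₑ ^ 2 * J x := by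
          refine lintegral_mono fun y => setLIntegral_mono' measurableSet_Ioc fun z hz => ?_
          rw [enorm_mul, mul_pow]
          gcongr
          exact enorm_sq_le_energyYZ hh x y hz
      _ = ∫⁻ y : ℝ, energyZ g x y * J x := lintegral_congr fun y =>
          lintegral_mul_const _ (measurable_enorm_sq_right hg.continuous x y)
      _ = energyYZ g x * J x :=
          lintegral_mul_const _ (measurable_energyZ_right hg.continuous x)
      _ = energy g * J x := by rw [energyYZ_eq_energy hgi x]
  calc energy (fun x y z => g x y z * h x y z)
      ≤ ∫⁻ x in Set.Ioc (0:ℝ) 1, energy g * J x := lintegral_mono fun x => hbound x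
    _ = energy g * (4 * (energy h + energy (pdy h)
          + (energy (pdz h) + energy (pdy (pdz h))))) := by
        rw [lintegral_const_mul _ (by fun_prop), hJ, lintegral_const_mul _ (by fun_prop),
          lintegral_add_left (by fun_prop), lintegral_add_left m0, lintegral_add_left m2]
        rfl
    _ = _ := by ring

/-- The `x`-independent factor in `L^∞`, the other one in `L²`. -/
theorem energy_mul_le_of_sup_left (hg : Smooth3 g) (hh : Smooth3 h)
    (hgx : ∀ x y z, pdx g x y z = 0) :
    energy (fun x y z => g x y z * h x y z)
      ≤ 4 * (energy g + energy (pdy g) + (energy (pdz g) + energy (pdy (pdz g)))) * energy h := by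
  have hgi := eq_of_pdx_eq_zero hg hgx
  have hgyi := eq_of_pdx_eq_zero hg.pdy (pdx_pderiv3_eq_zero hg hgx (0, 1, 0))
  have hgzi := eq_of_pdx_eq_zero hg.pdz (pdx_pderiv3_eq_zero hg hgx (0, 0, 1))
  have hgyzi := eq_of_pdx_eq_zero hg.pdz.pdy (pdx_pderiv3_eq_zero hg hgx (0, 1, 1))
  set K := 4 * (energy g + energy (pdy g) + (energy (pdz g) + energy (pdy (pdz g)))) with hK
  have hsup : ∀ x y, ∀ z ∈ Set.Ioc (0:ℝ) 1, ‖g x y z‖ₑ ^ 2 ≤ K := by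
    intro x y z hz
    have := enorm_sq_le_energyYZ hg x y hz
    rwa [energyYZ_eq_energy hgi, energyYZ_eq_energy hgyi, energyYZ_eq_energy hgzi,
      energyYZ_eq_energy hgyzi] at this
  calc energy (fun x y z => g x y z * h x y z)
      ≤ ∫⁻ x in Set.Ioc (0:ℝ) 1, ∫⁻ y : ℝ, ∫⁻ z in Set.Ioc (0:ℝ) 1,
          K * ‖h x y z‖ₑ ^ 2 := by
        refine lintegral_mono fun x => lintegral_mono fun y =>
          setLIntegral_mono' measurableSet_Ioc fun z hz => ?_
        rw [enorm_mul, mul_pow]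
        gcongr
        exact hsup x y z hz
    _ = ∫⁻ x in Set.Ioc (0:ℝ) 1, ∫⁻ y : ℝ, K * energyZ h x y :=
        lintegral_congr fun x => lintegral_congr fun y =>
          lintegral_const_mul _ (measurable_enorm_sq_right hh.continuous x y)
    _ = ∫⁻ x in Set.Ioc (0:ℝ) 1, K * energyYZ h x :=
        lintegral_congr fun x =>
          lintegral_const_mul _ (measurable_energyZ_right hh.continuous x)
    _ = K * energy h := lintegral_const_mul _ (measurable_energyYZ hh.continuous)

/-- The `x`-independent factor in `L²_y L^∞_z`, the other one in `L²_{x,z} L^∞_y`. -/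
theorem energy_mul_le_of_mixed (hg : Smooth3 g) (hh : Smooth3 h)
    (hgx : ∀ x y z, pdx g x y z = 0) :
    energy (fun x y z => g x y z * h x y z)
      ≤ 4 * (energy g + energy (pdz g)) * (energy h + energy (pdy h)) := by
  have hgi := eq_of_pdx_eq_zero hg hgx
  have hgzi := eq_of_pdx_eq_zero hg.pdz (pdx_pderiv3_eq_zero hg hgx (0, 0, 1))
  have hbound : ∀ x y, energyZ (fun x y z => g x y z * h x y z) x y
      ≤ (2 * (energyZ g x y + energyZ (pdz g) x y))
        * (2 * (energyYZ h x + energyYZ (pdy h) x)) := by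
    intro x y
    calc energyZ (fun x y z => g x y z * h x y z) x y
        ≤ ∫⁻ z in Set.Ioc (0:ℝ) 1,
            (2 * (energyZ g x y + energyZ (pdz g) x y)) * ‖h x y z‖ₑ ^ 2 := by
          refine setLIntegral_mono' measurableSet_Ioc fun z hz => ?_
          rw [enorm_mul, mul_pow]
          gcongr
          exact enorm_sq_le_energyZ hg x y hz
      _ = (2 * (energyZ g x y + energyZ (pdz g) x y)) * energyZ h x y :=
          lintegral_const_mul _ (measurable_enorm_sq_right hh.continuous x y)
      _ ≤ _ := by
          gcongr
          exact energyZ_le_energyYZ hh x y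
  have mg0 : ∀ x, Measurable (energyZ g x) := measurable_energyZ_right hg.continuous
  have mg1 : ∀ x, Measurable (energyZ (pdz g) x) := measurable_energyZ_right hg.pdz.continuous
  have m0 := measurable_energyYZ hh.continuous
  have m1 := measurable_energyYZ hh.pdy.continuous
  calc energy (fun x y z => g x y z * h x y z)
      ≤ ∫⁻ x in Set.Ioc (0:ℝ) 1, ∫⁻ y : ℝ, (2 * (energyZ g x y + energyZ (pdz g) x y))
          * (2 * (energyYZ h x + energyYZ (pdy h) x)) :=
        lintegral_mono fun x => lintegral_mono fun y => hbound x y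
    _ = ∫⁻ x in Set.Ioc (0:ℝ) 1, (2 * (energy g + energy (pdz g)))
          * (2 * (energyYZ h x + energyYZ (pdy h) x)) := by
        refine lintegral_congr fun x => ?_
        have mg : Measurable fun y => energyZ g x y + energyZ (pdz g) x y := (mg0 x).add (mg1 x)
        rw [lintegral_mul_const _ (mg.const_mul 2), lintegral_const_mul _ mg,
          lintegral_add_left (mg0 x),
          ← energyYZ_eq_energy hgi x, ← energyYZ_eq_energy hgzi x]
        rfl
    _ = (2 * (energy g + energy (pdz g))) * (2 * (energy h + energy (pdy h))) := by
        rw [lintegral_const_mul _ (by fun_prop), lintegral_const_mul _ (by fun_prop),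
          lintegral_add_left m0]
        rfl
    _ = _ := by ring

/-- A bound for all the products in the Leibniz formula bounds the derivative of a product. -/
theorem energy_pderiv3_mul_le (hg : Smooth3 g) (hh : Smooth3 h) (K : ℝ≥0∞)
    (α : ℕ × ℕ × ℕ)
    (hK : ∀ β γ, β + γ = α →
      energy (fun x y z => pderiv3 β g x y z * pderiv3 γ h x y z) ≤ K) :
    energy (pderiv3 α (fun x y z => g x y z * h x y z)) ≤ 4 ^ (α.1 + α.2.1 + α.2.2) * K := by
  obtain ⟨n, hn⟩ : ∃ n, α.1 + α.2.1 + α.2.2 = n := ⟨_, rfl⟩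
  rw [hn]
  have step : ∀ (m : ℕ) (g₁ h₁ g₂ h₂ : ℝ → ℝ → ℝ → ℂ) (δ : ℕ × ℕ × ℕ),
      Smooth3 g₁ → Smooth3 h₁ → Smooth3 g₂ → Smooth3 h₂ →
      energy (pderiv3 δ (fun x y z => g₁ x y z * h₁ x y z)) ≤ 4 ^ m * K →
      energy (pderiv3 δ (fun x y z => g₂ x y z * h₂ x y z)) ≤ 4 ^ m * K →
      energy (pderiv3 δ (fun x y z => g₁ x y z * h₁ x y z + g₂ x y z * h₂ x y z))
        ≤ 4 ^ (m + 1) * K := by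
    intro m g₁ h₁ g₂ h₂ δ s1 s2 s3 s4 e1 e2
    rw [pderiv3_add (s1.mul s2) (s3.mul s4)]
    refine (energy_add_le ((s1.mul s2).pderiv3 δ).continuous _).trans ?_
    refine (mul_le_mul_right (add_le_add e1 e2) 2).trans (le_of_eq ?_)
    ring
  induction n generalizing g h α with
  | zero =>
    obtain ⟨a, b, c⟩ := α
    simp only at hn
    obtain ⟨rfl, rfl, rfl⟩ : a = 0 ∧ b = 0 ∧ c = 0 := by omega
    rw [pow_zero, one_mul]
    exact hK (0, 0, 0) (0, 0, 0) rfl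
  | succ n ih =>
    obtain ⟨a, b, c⟩ := α
    simp only at hn
    rcases c with _ | c
    · rcases b with _ | b
      · rcases a with _ | a
        · omega
        · rw [← pderiv3_pdx (hg.mul hh), pdx_mul hg hh]
          refine step n _ _ _ _ _ hg.pdx hh hg hh.pdx
            (ih hg.pdx hh _ ?_ (by simp only; omega)) (ih hg hh.pdx _ ?_ (by simp only; omega))
          · rintro ⟨b1, b2, b3⟩ γ hβ
            rw [pderiv3_pdx hg]
            refine hK _ _ ?_
            simp only [Prod.ext_iff, Prod.fst_add, Prod.snd_add] at hβ ⊢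
            omega
          · rintro β ⟨b1, b2, b3⟩ hβ
            rw [pderiv3_pdx hh]
            refine hK _ _ ?_
            simp only [Prod.ext_iff, Prod.fst_add, Prod.snd_add] at hβ ⊢
            omega
      · rw [← pderiv3_pdy (hg.mul hh), pdy_mul hg hh]
        refine step n _ _ _ _ _ hg.pdy hh hg hh.pdy
          (ih hg.pdy hh _ ?_ (by simp only; omega)) (ih hg hh.pdy _ ?_ (by simp only; omega))
        · rintro ⟨b1, b2, b3⟩ γ hβ
          rw [pderiv3_pdy hg]
          refine hK _ _ ?_
          simp only [Prod.ext_iff, Prod.fst_add, Prod.snd_add] at hβ ⊢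
          omega
        · rintro β ⟨b1, b2, b3⟩ hβ
          rw [pderiv3_pdy hh]
          refine hK _ _ ?_
          simp only [Prod.ext_iff, Prod.fst_add, Prod.snd_add] at hβ ⊢
          omega
    · rw [← pderiv3_pdz, pdz_mul hg hh]
      refine step n _ _ _ _ _ hg.pdz hh hg hh.pdz
        (ih hg.pdz hh _ ?_ (by simp only; omega)) (ih hg hh.pdz _ ?_ (by simp only; omega))
      · rintro ⟨b1, b2, b3⟩ γ hβ
        rw [pderiv3_pdz]
        refine hK _ _ ?_
        simp only [Prod.ext_iff, Prod.fst_add, Prod.snd_add] at hβ ⊢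
        omega
      · rintro β ⟨b1, b2, b3⟩ hβ
        rw [pderiv3_pdz]
        refine hK _ _ ?_
        simp only [Prod.ext_iff, Prod.fst_add, Prod.snd_add] at hβ ⊢
        omega

end Bilinear

section Sobolev

/-- `‖f‖_{H^N}²` as an extended nonnegative number. -/
def energySum (N : ℕ) (f : ℝ → ℝ → ℝ → ℂ) : ℝ≥0∞ :=
  ∑ α ∈ multiIndicesLe N, energy (pderiv3 α f)

/-- Smooth functions all of whose derivatives are square integrable. -/
structure FiniteEnergy (f : ℝ → ℝ → ℝ → ℂ) : Prop where
  smooth : Smooth3 f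
  ne_top : ∀ α, energy (pderiv3 α f) ≠ ⊤

variable {f g : ℝ → ℝ → ℝ → ℂ}

theorem GoodFn.finiteEnergy (hf : GoodFn f) : FiniteEnergy f where
  smooth := hf.smooth
  ne_top α := by
    obtain ⟨C₀, h0⟩ := hf.decay α 0
    obtain ⟨C₁, h1⟩ := hf.decay α 1
    exact energy_ne_top_of_bound C₀ C₁ (by simpa using h0) (by simpa using h1)

theorem FiniteEnergy.pdz (hf : FiniteEnergy f) : FiniteEnergy (pdz f) where
  smooth := hf.smooth.pdz
  ne_top := fun (a, b, c) => hf.ne_top (a, b, c + 1)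

theorem FiniteEnergy.energySum_ne_top (hf : FiniteEnergy f) (N : ℕ) : energySum N f ≠ ⊤ :=
  ENNReal.sum_ne_top.2 fun α _ => hf.ne_top α

theorem mem_multiIndicesLe {N : ℕ} {α : ℕ × ℕ × ℕ} :
    α ∈ multiIndicesLe N ↔ α.1 + α.2.1 + α.2.2 ≤ N := by
  simp only [multiIndicesLe, Finset.mem_filter, Finset.mem_product, Finset.mem_range]
  omega

theorem energy_pderiv3_le_energySum (f : ℝ → ℝ → ℝ → ℂ) {N : ℕ} {α : ℕ × ℕ × ℕ}
    (hα : α.1 + α.2.1 + α.2.2 ≤ N) : energy (pderiv3 α f) ≤ energySum N f :=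
  Finset.single_le_sum (f := fun α => energy (pderiv3 α f)) (fun _ _ => zero_le)
    (mem_multiIndicesLe.2 hα)

theorem energySum_zero (f : ℝ → ℝ → ℝ → ℂ) : energySum 0 f = energy f := by
  have : multiIndicesLe 0 = {(0, 0, 0)} := by decide
  rw [energySum, this, Finset.sum_singleton]
  rfl

theorem HN_eq_sqrt_energySum (hf : Smooth3 f) {N : ℕ} (h : energySum N f ≠ ⊤) :
    HN N f = √(energySum N f).toReal := by
  rw [HN, HNsq, energySum, ENNReal.toReal_sum (ENNReal.sum_ne_top.1 h)]
  exact congrArg _ (Finset.sum_congr rfl fun α hα =>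
    L2sq_eq_toReal_energy (hf.pderiv3 α).continuous (ENNReal.sum_ne_top.1 h α hα))

theorem L2norm_eq_sqrt_energy (hf : Smooth3 f) (h : energy f ≠ ⊤) :
    L2norm f = √(energy f).toReal := by
  rw [L2norm, L2sq_eq_toReal_energy hf.continuous h]

/-- Estimate of a product of derivatives, with the supremum in `y` on the first factor. -/
theorem energy_mul_pderiv3_le_of_left (hf : Smooth3 f) (hg : Smooth3 g)
    (hfx : ∀ x y z, pdx f x y z = 0) {β γ : ℕ × ℕ × ℕ} {p q : ℕ}
    (hβ : β.1 + β.2.1 + β.2.2 + 1 ≤ p) (hγ : γ.1 + γ.2.1 + γ.2.2 ≤ q) :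
    energy (fun x y z => pderiv3 β f x y z * pderiv3 γ g x y z)
      ≤ 8 * (energySum p f * (energySum q g + energySum q (pdz g))) := by
  refine (energy_mul_le_of_energyZ (hf.pderiv3 β) (hg.pderiv3 γ)
    (pdx_pderiv3_eq_zero hf hfx β)).trans ?_
  obtain ⟨b1, b2, b3⟩ := β
  simp only at hβ
  rw [pdy_pderiv3 hf, pdz_pderiv3 hg, pderiv3_pdy hf]
  have e1 := energy_pderiv3_le_energySum f (N := p) (α := (b1, b2, b3)) (by simp only; omega)
  have e2 := energy_pderiv3_le_energySum f (N := p) (α := (b1, b2 + 1, b3)) (by simp only; omega)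
  have e3 := energy_pderiv3_le_energySum g hγ
  have e4 := energy_pderiv3_le_energySum (pdz g) hγ
  refine (mul_le_mul' (mul_le_mul_right (add_le_add e1 e2) 4) (add_le_add e3 e4)).trans
    (le_of_eq ?_)
  ring

/-- Estimate of a product of derivatives, with the supremum in `y` on the second factor. -/
theorem energy_mul_pderiv3_le_of_right (hf : Smooth3 f) (hg : Smooth3 g)
    (hfx : ∀ x y z, pdx f x y z = 0) {β γ : ℕ × ℕ × ℕ} {p q : ℕ}
    (hβ : β.1 + β.2.1 + β.2.2 ≤ p) (hγ : γ.1 + γ.2.1 + γ.2.2 + 1 ≤ q) :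
    energy (fun x y z => pderiv3 β f x y z * pderiv3 γ g x y z)
      ≤ 8 * (energySum p f * (energySum q g + energySum q (pdz g))) := by
  refine (energy_mul_le_of_sup_right (hf.pderiv3 β) (hg.pderiv3 γ)
    (pdx_pderiv3_eq_zero hf hfx β)).trans ?_
  obtain ⟨c1, c2, c3⟩ := γ
  simp only at hγ
  rw [pdz_pderiv3 hg, pdy_pderiv3 hg, pdy_pderiv3 hg.pdz, pderiv3_pdy hg, pderiv3_pdy hg.pdz]
  have e0 := energy_pderiv3_le_energySum f hβ
  have e1 := energy_pderiv3_le_energySum g (N := q) (α := (c1, c2, c3)) (by simp only; omega)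
  have e2 := energy_pderiv3_le_energySum g (N := q) (α := (c1, c2 + 1, c3)) (by simp only; omega)
  have e3 := energy_pderiv3_le_energySum (pdz g) (N := q) (α := (c1, c2, c3))
    (by simp only; omega)
  have e4 := energy_pderiv3_le_energySum (pdz g) (N := q) (α := (c1, c2 + 1, c3))
    (by simp only; omega)
  refine (mul_le_mul' (mul_le_mul_right e0 4)
    (add_le_add (add_le_add e1 e2) (add_le_add e3 e4))).trans (le_of_eq ?_)
  ring

theorem energySum_mul_le (hf : Smooth3 f) (hg : Smooth3 g)
    (hfx : ∀ x y z, pdx f x y z = 0) {M : ℕ} (hM : M ≤ 1) :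
    energySum (M + 2) (fun x y z => f x y z * g x y z)
      ≤ 40000 * (energySum 1 f * (energySum (M + 2) g + energySum (M + 2) (pdz g))
          + energySum 3 f * (energySum M g + energySum M (pdz g))) := by
  set P := energySum 1 f * (energySum (M + 2) g + energySum (M + 2) (pdz g)) with hP
  set Q := energySum 3 f * (energySum M g + energySum M (pdz g)) with hQ
  have hprod : ∀ β γ : ℕ × ℕ × ℕ,
      (β.1 + β.2.1 + β.2.2) + (γ.1 + γ.2.1 + γ.2.2) ≤ M + 2 →
      energy (fun x y z => pderiv3 β f x y z * pderiv3 γ g x y z) ≤ 8 * (P + Q) := by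
    intro β γ hβγ
    have hPle : 8 * P ≤ 8 * (P + Q) := mul_le_mul_right le_self_add 8
    have hQle : 8 * Q ≤ 8 * (P + Q) := mul_le_mul_right le_add_self 8
    obtain h | h | h | h : β.1 + β.2.1 + β.2.2 = 0 ∨ β.1 + β.2.1 + β.2.2 = 1 ∨
        β.1 + β.2.1 + β.2.2 = 2 ∨ β.1 + β.2.1 + β.2.2 = 3 := by omega
    · exact (energy_mul_pderiv3_le_of_left hf hg hfx (by omega) (by omega)).trans hPle
    · exact (energy_mul_pderiv3_le_of_right hf hg hfx (by omega) (by omega)).trans hPle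
    · exact (energy_mul_pderiv3_le_of_left hf hg hfx (by omega) (by omega)).trans hQle
    · exact (energy_mul_pderiv3_le_of_right hf hg hfx (by omega) (by omega)).trans hQle
  have hterm : ∀ α ∈ multiIndicesLe (M + 2),
      energy (pderiv3 α (fun x y z => f x y z * g x y z)) ≤ 512 * (P + Q) := by
    intro α hα
    have hα' := mem_multiIndicesLe.1 hα
    refine (energy_pderiv3_mul_le hf hg (8 * (P + Q)) α fun β γ h => hprod β γ ?_).trans ?_
    · subst h
      simp only [Prod.fst_add, Prod.snd_add] at hα'
      omega
    · have h4 : (4 : ℝ≥0∞) ^ (α.1 + α.2.1 + α.2.2) ≤ 4 ^ 3 :=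
        pow_le_pow_right₀ (by norm_num) (by omega)
      refine (mul_le_mul_left h4 _).trans (le_of_eq ?_)
      ring
  refine (Finset.sum_le_card_nsmul _ _ _ hterm).trans ?_
  have hcard : (multiIndicesLe (M + 2)).card ≤ 64 := by
    interval_cases M <;> decide
  rw [nsmul_eq_mul, ← mul_assoc]
  gcongr
  calc ((multiIndicesLe (M + 2)).card : ℝ≥0∞) * 512 ≤ (64 : ℕ) * 512 := by gcongr
    _ ≤ 40000 := by norm_num

theorem energy_grad_mul_le (hf : Smooth3 f) (hg : Smooth3 g)
    (hfx : ∀ x y z, pdx f x y z = 0) {α : ℕ × ℕ × ℕ} (hα : α.1 + α.2.1 + α.2.2 = 1) :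
    energy (pderiv3 α (fun x y z => f x y z * g x y z))
      ≤ 32 * (energySum 1 g * (energySum 1 f + energySum 1 (pdz f))) := by
  have hprod : ∀ β γ : ℕ × ℕ × ℕ, β + γ = α →
      energy (fun x y z => pderiv3 β f x y z * pderiv3 γ g x y z)
        ≤ 8 * (energySum 1 g * (energySum 1 f + energySum 1 (pdz f))) := by
    rintro ⟨b1, b2, b3⟩ ⟨c1, c2, c3⟩ rfl
    simp only [Prod.fst_add, Prod.snd_add] at hα
    have hx := pdx_pderiv3_eq_zero hf hfx (b1, b2, b3)
    rcases Nat.eq_zero_or_pos (b1 + b2 + b3) with h | h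
    · refine (energy_mul_le_of_sup_left (hf.pderiv3 _) (hg.pderiv3 _) hx).trans ?_
      rw [pdz_pderiv3 hf, pdy_pderiv3 hf, pdy_pderiv3 hf.pdz, pderiv3_pdy hf,
        pderiv3_pdy hf.pdz]
      have e0 := energy_pderiv3_le_energySum g (N := 1) (α := (c1, c2, c3))
        (by simp only; omega)
      have e1 := energy_pderiv3_le_energySum f (N := 1) (α := (b1, b2, b3))
        (by simp only; omega)
      have e2 := energy_pderiv3_le_energySum f (N := 1) (α := (b1, b2 + 1, b3))
        (by simp only; omega)
      have e3 := energy_pderiv3_le_energySum (pdz f) (N := 1) (α := (b1, b2, b3))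
        (by simp only; omega)
      have e4 := energy_pderiv3_le_energySum (pdz f) (N := 1) (α := (b1, b2 + 1, b3))
        (by simp only; omega)
      refine (mul_le_mul' (mul_le_mul_right
        (add_le_add (add_le_add e1 e2) (add_le_add e3 e4)) 4) e0).trans (le_of_eq ?_)
      ring
    · refine (energy_mul_le_of_mixed (hf.pderiv3 _) (hg.pderiv3 _) hx).trans ?_
      rw [pdz_pderiv3 hf, pdy_pderiv3 hg, pderiv3_pdy hg]
      have e1 := energy_pderiv3_le_energySum f (N := 1) (α := (b1, b2, b3))
        (by simp only; omega)
      have e2 := energy_pderiv3_le_energySum (pdz f) (N := 1) (α := (b1, b2, b3))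
        (by simp only; omega)
      have e3 := energy_pderiv3_le_energySum g (N := 1) (α := (c1, c2, c3))
        (by simp only; omega)
      have e4 := energy_pderiv3_le_energySum g (N := 1) (α := (c1, c2 + 1, c3))
        (by simp only; omega)
      refine (mul_le_mul' (mul_le_mul_right (add_le_add e1 e2) 4)
        (add_le_add e3 e4)).trans (le_of_eq ?_)
      ring
  refine (energy_pderiv3_mul_le hf hg _ α hprod).trans (le_of_eq ?_)
  rw [hα]
  ring

/-- Passage from a quadratic estimate to the corresponding estimate for norms. -/
theorem ne_top_and_sqrt_toReal_le {X a b b' c d d' : ℝ≥0∞} (ha : a ≠ ⊤) (hb : b ≠ ⊤)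
    (hb' : b' ≠ ⊤) (hc : c ≠ ⊤) (hd : d ≠ ⊤) (hd' : d' ≠ ⊤)
    (h : X ≤ 40000 * (a * (b + b') + c * (d + d'))) :
    X ≠ ⊤ ∧ √X.toReal ≤ 200 * √a.toReal * (√b.toReal + √b'.toReal)
      + 200 * √c.toReal * (√d.toReal + √d'.toReal) := by
  have hfin : 40000 * (a * (b + b') + c * (d + d')) ≠ ⊤ := by finiteness
  refine ⟨ne_top_of_le_ne_top hfin h, ?_⟩
  have hle := ENNReal.toReal_mono hfin h
  rw [ENNReal.toReal_mul, ENNReal.toReal_add (by finiteness) (by finiteness),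
    ENNReal.toReal_mul, ENNReal.toReal_mul, ENNReal.toReal_add hb hb',
    ENNReal.toReal_add hd hd', ENNReal.toReal_ofNat] at hle
  have sq : ∀ t : ℝ≥0∞, t.toReal = √t.toReal ^ 2 := fun t =>
    (Real.sq_sqrt ENNReal.toReal_nonneg).symm
  rw [sq a, sq b, sq b', sq c, sq d, sq d'] at hle
  refine Real.sqrt_le_iff.2 ⟨by positivity, hle.trans ?_⟩
  set u := √a.toReal * (√b.toReal + √b'.toReal) with hu
  set v := √c.toReal * (√d.toReal + √d'.toReal) with hv
  have h1 : √a.toReal ^ 2 * (√b.toReal ^ 2 + √b'.toReal ^ 2) ≤ u ^ 2 := by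
    rw [hu, mul_pow]
    gcongr
    nlinarith [mul_nonneg (Real.sqrt_nonneg b.toReal) (Real.sqrt_nonneg b'.toReal)]
  have h2 : √c.toReal ^ 2 * (√d.toReal ^ 2 + √d'.toReal ^ 2) ≤ v ^ 2 := by
    rw [hv, mul_pow]
    gcongr
    nlinarith [mul_nonneg (Real.sqrt_nonneg d.toReal) (Real.sqrt_nonneg d'.toReal)]
  have huv : 0 ≤ u * v := by positivity
  rw [mul_assoc, ← hu, mul_assoc 200, ← hv]
  nlinarith

end Sobolev

/-- Anisotropic bilinear estimates when `∂_x f₁ = 0`: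
(i) `‖f₁ f₂‖_{L²} ≤ C‖f₁‖_{H¹}(‖f₂‖_{L²} + ‖∂_z f₂‖_{L²})`;
(ii) `‖∇(f₁ f₂)‖_{L²} ≤ C(‖f₁‖_{H¹} + ‖∂_z f₁‖_{H¹})‖f₂‖_{H¹}`;
(iii) `‖f₁ f₂‖_{H²} ≤ C‖f₁‖_{H¹}(‖f₂‖_{H²} + ‖∂_z f₂‖_{H²}) + C‖f₁‖_{H³}(‖f₂‖_{L²} + ‖∂_z f₂‖_{L²})`;
(iv) `‖f₁ f₂‖_{H³} ≤ C‖f₁‖_{H¹}(‖f₂‖_{H³} + ‖∂_z f₂‖_{H³}) + C‖f₁‖_{H³}(‖f₂‖_{H¹} + ‖∂_z f₂‖_{H¹})`. -/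
theorem stmt14 : ∃ C : ℝ, 0 < C ∧ ∀ f₁ f₂ : ℝ → ℝ → ℝ → ℂ,
    GoodFn f₁ → GoodFn f₂ →
    (∀ x y z, pdx f₁ x y z = 0) →
    L2norm (fun x y z => f₁ x y z * f₂ x y z)
      ≤ C * HN 1 f₁ * (L2norm f₂ + L2norm (pdz f₂)) ∧
    gradL2norm (fun x y z => f₁ x y z * f₂ x y z)
      ≤ C * (HN 1 f₁ + HN 1 (pdz f₁)) * HN 1 f₂ ∧
    HN 2 (fun x y z => f₁ x y z * f₂ x y z)
      ≤ C * HN 1 f₁ * (HN 2 f₂ + HN 2 (pdz f₂))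
        + C * HN 3 f₁ * (L2norm f₂ + L2norm (pdz f₂)) ∧
    HN 3 (fun x y z => f₁ x y z * f₂ x y z)
      ≤ C * HN 1 f₁ * (HN 3 f₂ + HN 3 (pdz f₂))
        + C * HN 3 f₁ * (HN 1 f₂ + HN 1 (pdz f₂)) := by
  refine ⟨200, by norm_num, fun f₁ f₂ hf₁ hf₂ hx => ?_⟩
  have F₁ := hf₁.finiteEnergy
  have F₂ := hf₂.finiteEnergy
  have hs := F₁.smooth.mul F₂.smooth
  have hHN : ∀ {f}, FiniteEnergy f → ∀ N, HN N f = √(energySum N f).toReal :=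
    fun hf N => HN_eq_sqrt_energySum hf.smooth (hf.energySum_ne_top N)
  have hL2 : ∀ {f}, FiniteEnergy f → L2norm f = √(energySum 0 f).toReal := fun hf => by
    rw [energySum_zero]
    exact L2norm_eq_sqrt_energy hf.smooth (hf.ne_top (0, 0, 0))
  refine ⟨?_, ?_, ?_, ?_⟩
  · have key : energy (fun x y z => f₁ x y z * f₂ x y z)
        ≤ 40000 * (energySum 1 f₁ * (energySum 0 f₂ + energySum 0 (pdz f₂)) + 0 * (0 + 0)) := by
      refine (energy_mul_pderiv3_le_of_left F₁.smooth F₂.smooth hx (β := (0, 0, 0))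
        (γ := (0, 0, 0)) (p := 1) (q := 0) (by simp) (by simp)).trans ?_
      rw [zero_mul, add_zero]
      gcongr
      norm_num
    obtain ⟨hne, hle⟩ := ne_top_and_sqrt_toReal_le (F₁.energySum_ne_top 1)
      (F₂.energySum_ne_top 0) (F₂.pdz.energySum_ne_top 0) (by simp) (by simp) (by simp) key
    rw [L2norm_eq_sqrt_energy hs hne, hHN F₁, hL2 F₂, hL2 F₂.pdz]
    simpa using hle
  · have hgrad : ∀ {α : ℕ × ℕ × ℕ}, α.1 + α.2.1 + α.2.2 = 1 → _ :=
      fun {α} hα => energy_grad_mul_le F₁.smooth F₂.smooth hx (α := α) hα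
    have key : energy (pderiv3 (1, 0, 0) (fun x y z => f₁ x y z * f₂ x y z))
          + energy (pderiv3 (0, 1, 0) (fun x y z => f₁ x y z * f₂ x y z))
          + energy (pderiv3 (0, 0, 1) (fun x y z => f₁ x y z * f₂ x y z))
        ≤ 40000 * (energySum 1 f₂ * (energySum 1 f₁ + energySum 1 (pdz f₁)) + 0 * (0 + 0)) := by
      refine (add_le_add (add_le_add (hgrad (by simp)) (hgrad (by simp)))
        (hgrad (by simp))).trans ?_
      rw [zero_mul, add_zero, ← add_mul, ← add_mul]
      gcongr
      norm_num
    obtain ⟨hne, hle⟩ := ne_top_and_sqrt_toReal_le (F₂.energySum_ne_top 1)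
      (F₁.energySum_ne_top 1) (F₁.pdz.energySum_ne_top 1) (by simp) (by simp) (by simp) key
    obtain ⟨hne', hz⟩ := ENNReal.add_ne_top.1 hne
    obtain ⟨hx', hy⟩ := ENNReal.add_ne_top.1 hne'
    rw [ENNReal.toReal_add hne' hz, ENNReal.toReal_add hx' hy,
      ← L2sq_eq_toReal_energy (hs.pderiv3 _).continuous hx',
      ← L2sq_eq_toReal_energy (hs.pderiv3 _).continuous hy,
      ← L2sq_eq_toReal_energy (hs.pderiv3 _).continuous hz,
      ← hHN F₁, ← hHN F₂, ← hHN F₁.pdz] at hle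
    refine hle.trans (le_of_eq ?_)
    simp
    ring
  · obtain ⟨hne, hle⟩ := ne_top_and_sqrt_toReal_le (F₁.energySum_ne_top 1)
      (F₂.energySum_ne_top 2) (F₂.pdz.energySum_ne_top 2) (F₁.energySum_ne_top 3)
      (F₂.energySum_ne_top 0) (F₂.pdz.energySum_ne_top 0)
      (energySum_mul_le F₁.smooth F₂.smooth hx (M := 0) (by norm_num))
    rw [HN_eq_sqrt_energySum hs hne, hHN F₁, hHN F₁, hHN F₂, hHN F₂.pdz, hL2 F₂, hL2 F₂.pdz]
    exact hle
  · obtain ⟨hne, hle⟩ := ne_top_and_sqrt_toReal_le (F₁.energySum_ne_top 1)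
      (F₂.energySum_ne_top 3) (F₂.pdz.energySum_ne_top 3) (F₁.energySum_ne_top 3)
      (F₂.energySum_ne_top 1) (F₂.pdz.energySum_ne_top 1)
      (energySum_mul_le F₁.smooth F₂.smooth hx (M := 1) le_rfl)
    rw [HN_eq_sqrt_energySum hs hne, hHN F₁, hHN F₁, hHN F₂, hHN F₂.pdz, hHN F₂, hHN F₂.pdz]
    exact hle

end
end
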